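/- arXiv:1805.11153 — 3 statements merged into one kernel-verified Lean document; each statement's English description precedes it below -/
import Mathlib

section
/- Let p : ℕ → (0,1) be a sequence of edge probabilities with p(n) → 0 as n → ∞, and suppose that the sequence 2·log n − n·p(n)² − log 2 converges to some real number c with c < 0. Then for every ε > 0 there exists N such that for all n ≥ N, P(n,p(n)) ≥ (1−ε)·(1 − e^{c}). -/
open scoped Classical

/-- The probability that a random simple graph on `n` labelled vertices, in which each of
the `n.choose 2` possible edges is included independently with probability `p`, is
connected with diameter at most `2`. -/
noncomputable def diam2Prob (n : ℕ) (p : ℝ) : ℝ :=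
  ∑ G : SimpleGraph (Fin n),
    if G.Connected ∧ ∀ u v : Fin n, G.dist u v ≤ 2 then
      p ^ Nat.card G.edgeSet * (1 - p) ^ (n.choose 2 - Nat.card G.edgeSet)
    else 0

/-- The binomial random subset of `E` contains a fixed `A ⊆ E` with probability `p ^ #A`. -/
theorem sum_powerset_superset_weight {α : Type*} (E A : Finset α) (hA : A ⊆ E) (p : ℝ) :
    ∑ S ∈ E.powerset, (p ^ S.card * (1 - p) ^ (E.card - S.card)) * (if A ⊆ S then 1 else 0)
      = p ^ A.card := by
  have h := Finset.prod_add (fun _ : α => p) (fun e => if e ∈ A then 0 else 1 - p) E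
  have hl : ∏ e ∈ E, (p + if e ∈ A then 0 else 1 - p) = p ^ A.card := by
    rw [← Finset.prod_const, ← Finset.prod_subset hA]
    · exact Finset.prod_congr rfl fun e he => by simp [he]
    · intro e _ he
      simp [he]
  rw [← hl, h]
  refine Finset.sum_congr rfl fun S hS => ?_
  rw [Finset.mem_powerset] at hS
  rw [Finset.prod_const, mul_assoc]
  congr 1
  split_ifs with hAS
  · rw [mul_one, ← Finset.card_sdiff_of_subset hS, ← Finset.prod_const]
    refine Finset.prod_congr rfl fun e he => ?_
    rw [if_neg fun hea => (Finset.mem_sdiff.mp he).2 (hAS hea)]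
  · obtain ⟨a, ha, haS⟩ := Finset.not_subset.mp hAS
    rw [mul_zero, eq_comm]
    exact Finset.prod_eq_zero (Finset.mem_sdiff.mpr ⟨hA ha, haS⟩) (by simp [ha])

/-- The binomial random subset of `E` contains none of the pairwise disjoint two-element sets
`B i`, `i ∈ I`, with probability `(1 - p ^ 2) ^ #I`. -/
theorem sum_powerset_avoid_weight {α ι : Type*} (E : Finset α) (I : Finset ι)
    (B : ι → Finset α) (hB : ∀ i ∈ I, B i ⊆ E) (hcard : ∀ i ∈ I, (B i).card = 2)
    (hdisj : (I : Set ι).PairwiseDisjoint B) (p : ℝ) :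
    ∑ S ∈ E.powerset, (p ^ S.card * (1 - p) ^ (E.card - S.card)) *
        (if ∀ i ∈ I, ¬ B i ⊆ S then 1 else 0) = (1 - p ^ 2) ^ I.card := by
  have hind : ∀ S : Finset α, (if ∀ i ∈ I, ¬ B i ⊆ S then (1 : ℝ) else 0) =
      ∑ T ∈ I.powerset, (-1) ^ T.card * (if T.biUnion B ⊆ S then 1 else 0) := by
    intro S
    have h1 : (if ∀ i ∈ I, ¬ B i ⊆ S then (1 : ℝ) else 0) =
        ∏ i ∈ I, ((-(if B i ⊆ S then 1 else 0)) + 1) := by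
      split_ifs with h
      · exact (Finset.prod_eq_one fun i hi => by simp [h i hi]).symm
      · push Not at h
        obtain ⟨i, hi, hiS⟩ := h
        exact (Finset.prod_eq_zero hi (by simp [hiS])).symm
    rw [h1, Finset.prod_add]
    refine Finset.sum_congr rfl fun T _ => ?_
    rw [Finset.prod_const_one, mul_one, Finset.prod_neg, Finset.prod_ite_zero]
    simp
  have h2 : (1 - p ^ 2) ^ I.card = ∑ T ∈ I.powerset, (-1) ^ T.card * p ^ (T.biUnion B).card := by
    have h3 : (1 - p ^ 2) ^ I.card = ∏ i ∈ I, (-p ^ 2 + 1) := by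
      rw [Finset.prod_const]; ring
    rw [h3, Finset.prod_add]
    refine Finset.sum_congr rfl fun T hT => ?_
    rw [Finset.mem_powerset] at hT
    rw [Finset.card_biUnion fun i hi j hj hij => hdisj (hT hi) (hT hj) hij,
      Finset.sum_congr rfl fun i hi => hcard i (hT hi)]
    simp only [Finset.prod_const, Finset.sum_const, smul_eq_mul, one_pow, mul_one]
    rw [← neg_one_mul, mul_pow, ← pow_mul, mul_comm T.card 2]
  simp_rw [hind, Finset.mul_sum]
  rw [Finset.sum_comm, h2]
  refine Finset.sum_congr rfl fun T hT => ?_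
  rw [Finset.mem_powerset] at hT
  rw [← sum_powerset_superset_weight E (T.biUnion B)
    (Finset.biUnion_subset.mpr fun i hi => hB i (hT hi)) p, Finset.mul_sum]
  exact Finset.sum_congr rfl fun S _ => by ring

/-- A sum over graphs is a sum over sets of edges of the complete graph. -/
theorem sum_simpleGraph_eq_sum_powerset {n : ℕ} (f : Finset (Sym2 (Fin n)) → ℝ) :
    ∑ G : SimpleGraph (Fin n), f G.edgeFinset =
      ∑ S ∈ (⊤ : SimpleGraph (Fin n)).edgeFinset.powerset, f S := by
  refine Finset.sum_bij (fun G _ => G.edgeFinset) ?_ ?_ ?_ ?_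
  · intro G _
    rw [Finset.mem_powerset, SimpleGraph.edgeFinset_subset_edgeFinset]
    exact le_top
  · intro G _ H _ h
    exact SimpleGraph.edgeFinset_inj.mp h
  · intro S hS
    refine ⟨SimpleGraph.fromEdgeSet S, Finset.mem_univ _, ?_⟩
    ext e
    rw [Finset.mem_powerset] at hS
    simp only [SimpleGraph.mem_edgeFinset, SimpleGraph.edgeSet_fromEdgeSet, Set.mem_sdiff,
      Finset.mem_coe]
    refine ⟨fun h => h.1, fun h => ⟨h, ?_⟩⟩
    have := hS h
    simpa using this
  · intro G _
    rfl

/-- The probability of a graph `G` in the binomial random graph model. -/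
noncomputable def graphWeight {n : ℕ} (p : ℝ) (G : SimpleGraph (Fin n)) : ℝ :=
  p ^ Nat.card G.edgeSet * (1 - p) ^ (n.choose 2 - Nat.card G.edgeSet)

theorem graphWeight_nonneg {n : ℕ} {p : ℝ} (h0 : 0 ≤ p) (h1 : p ≤ 1)
    (G : SimpleGraph (Fin n)) : 0 ≤ graphWeight p G :=
  mul_nonneg (pow_nonneg h0 _) (pow_nonneg (sub_nonneg.mpr h1) _)

theorem graphWeight_eq {n : ℕ} (p : ℝ) (G : SimpleGraph (Fin n)) :
    graphWeight p G = p ^ G.edgeFinset.card *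
      (1 - p) ^ ((⊤ : SimpleGraph (Fin n)).edgeFinset.card - G.edgeFinset.card) := by
  have h : (⊤ : SimpleGraph (Fin n)).edgeFinset.card = n.choose 2 := by
    have := SimpleGraph.card_edgeFinset_top_eq_card_choose_two (V := Fin n)
    rw [Fintype.card_fin] at this
    rw [← this]
  rw [graphWeight, h, Nat.card_eq_fintype_card, ← SimpleGraph.edgeFinset_card]

theorem sum_graphWeight (n : ℕ) (p : ℝ) :
    ∑ G : SimpleGraph (Fin n), graphWeight p G = 1 := by
  have h := sum_powerset_superset_weight (⊤ : SimpleGraph (Fin n)).edgeFinset ∅ (by simp) p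
  rw [← sum_simpleGraph_eq_sum_powerset] at h
  simpa [graphWeight_eq] using h

/-- Two distinct vertices have no common neighbour with probability `(1 - p ^ 2) ^ (n - 2)`. -/
theorem sum_graphWeight_no_common_neighbor {n : ℕ} (p : ℝ) {u v : Fin n} (huv : u ≠ v) :
    ∑ G : SimpleGraph (Fin n), graphWeight p G *
      (if ∀ w, ¬ (G.Adj u w ∧ G.Adj v w) then 1 else 0) = (1 - p ^ 2) ^ (n - 2) := by
  have h := sum_powerset_avoid_weight (⊤ : SimpleGraph (Fin n)).edgeFinset
    ({u, v}ᶜ : Finset (Fin n)) (fun w => {s(u, w), s(v, w)}) ?_ ?_ ?_ p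
  · rw [← sum_simpleGraph_eq_sum_powerset] at h
    rw [Finset.card_compl, Finset.card_pair huv, Fintype.card_fin] at h
    rw [← h]
    refine Finset.sum_congr rfl fun G _ => ?_
    rw [graphWeight_eq]
    congr 2
    simp only [Finset.mem_compl, Finset.insert_subset_iff, Finset.singleton_subset_iff,
      SimpleGraph.mem_edgeFinset, SimpleGraph.mem_edgeSet, eq_iff_iff]
    refine ⟨fun h w _ => h w, fun h w hw => h w ?_ hw⟩
    simp only [Finset.mem_insert, Finset.mem_singleton, not_or]
    exact ⟨hw.1.ne', hw.2.ne'⟩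
  · intro w hw e he
    simp only [Finset.mem_compl, Finset.mem_insert, Finset.mem_singleton, not_or] at hw he
    rcases he with rfl | rfl
    · simpa using Ne.symm hw.1
    · simpa using Ne.symm hw.2
  · intro w hw
    simp only [Finset.mem_compl, Finset.mem_insert, Finset.mem_singleton, not_or] at hw
    refine Finset.card_pair ?_
    simp [huv]
    grind
  · intro w hw x hx hwx
    simp only [Finset.coe_compl, Finset.coe_insert, Finset.coe_singleton, Set.mem_compl_iff,
      Set.mem_insert_iff, Set.mem_singleton_iff, not_or] at hw hx
    simp only [Function.onFun, Finset.disjoint_left, Finset.mem_insert, Finset.mem_singleton]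
    intro e he he'
    rcases he with rfl | rfl <;> rcases he' with he' | he' <;>
      simp only [Sym2.eq_iff] at he' <;> grind

theorem connected_and_dist_le_two {n : ℕ} (hn : 0 < n) (G : SimpleGraph (Fin n))
    (h : ∀ u v : Fin n, u < v → ∃ w, G.Adj u w ∧ G.Adj v w) :
    G.Connected ∧ ∀ u v : Fin n, G.dist u v ≤ 2 := by
  have hwalk : ∀ u v : Fin n, ∃ q : G.Walk u v, q.length ≤ 2 := by
    intro u v
    rcases lt_trichotomy u v with huv | rfl | huv
    · obtain ⟨w, huw, hvw⟩ := h u v huv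
      exact ⟨.cons huw (.cons hvw.symm .nil), by simp⟩
    · exact ⟨.nil, by simp⟩
    · obtain ⟨w, hvw, huw⟩ := h v u huv
      exact ⟨.cons huw (.cons hvw.symm .nil), by simp⟩
  have : Nonempty (Fin n) := ⟨⟨0, hn⟩⟩
  refine ⟨⟨fun u v => ?_⟩, fun u v => ?_⟩
  · obtain ⟨q, _⟩ := hwalk u v
    exact q.reachable
  · obtain ⟨q, hq⟩ := hwalk u v
    exact (SimpleGraph.dist_le q).trans hq

theorem two_mul_card_filter_lt_le (n : ℕ) :
    2 * (Finset.univ.filter fun x : Fin n × Fin n => x.1 < x.2).card ≤ n ^ 2 := by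
  have hswap : (Finset.univ.filter fun x : Fin n × Fin n => x.1 < x.2).card =
      (Finset.univ.filter fun x : Fin n × Fin n => x.2 < x.1).card :=
    Finset.card_bij (fun x _ => x.swap) (by simp) (by simp [Prod.swap_inj])
      (fun x hx => ⟨x.swap, by simpa using hx, by simp⟩)
  have hd : Disjoint (Finset.univ.filter fun x : Fin n × Fin n => x.1 < x.2)
      (Finset.univ.filter fun x : Fin n × Fin n => x.2 < x.1) := by
    rw [Finset.disjoint_filter]
    exact fun x _ h => h.asymm
  have h := Finset.card_le_univ (Finset.disjUnion _ _ hd)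
  rw [Finset.card_disjUnion, ← hswap, Fintype.card_prod, Fintype.card_fin] at h
  nlinarith

/-- First moment bound for the property of having diameter at most two. -/
theorem one_sub_le_diam2Prob {n : ℕ} (hn : 0 < n) {p : ℝ} (h0 : 0 ≤ p) (h1 : p ≤ 1) :
    1 - (n : ℝ) ^ 2 / 2 * (1 - p ^ 2) ^ (n - 2) ≤ diam2Prob n p := by
  set Q := Finset.univ.filter fun x : Fin n × Fin n => x.1 < x.2 with hQ
  have hbound : ∀ G : SimpleGraph (Fin n), graphWeight p G ≤
      (if G.Connected ∧ ∀ u v : Fin n, G.dist u v ≤ 2 then graphWeight p G else 0) +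
      ∑ x ∈ Q, graphWeight p G *
        (if ∀ w, ¬ (G.Adj x.1 w ∧ G.Adj x.2 w) then 1 else 0) := by
    intro G
    have hw := graphWeight_nonneg h0 h1 G
    have hterm : ∀ x ∈ Q, 0 ≤ graphWeight p G *
        (if ∀ w, ¬ (G.Adj x.1 w ∧ G.Adj x.2 w) then (1 : ℝ) else 0) :=
      fun x _ => mul_nonneg hw (by split_ifs <;> norm_num)
    by_cases hG : G.Connected ∧ ∀ u v : Fin n, G.dist u v ≤ 2
    · rw [if_pos hG]
      linarith [Finset.sum_nonneg hterm]
    · rw [if_neg hG, zero_add]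
      have hbad := mt (connected_and_dist_le_two hn G) hG
      push Not at hbad
      obtain ⟨u, v, huv, hno⟩ := hbad
      refine le_trans ?_ (Finset.single_le_sum hterm
        (show (u, v) ∈ Q from Finset.mem_filter.mpr ⟨Finset.mem_univ _, huv⟩))
      rw [if_pos fun w hw => hno w hw.1 hw.2, mul_one]
  have hsum := Finset.sum_le_sum fun G (_ : G ∈ Finset.univ) => hbound G
  rw [sum_graphWeight, Finset.sum_add_distrib, Finset.sum_comm,
    Finset.sum_congr rfl fun x hx =>
      sum_graphWeight_no_common_neighbor p (Finset.mem_filter.mp hx).2.ne,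
    Finset.sum_const, nsmul_eq_mul] at hsum
  have hcard : (Q.card : ℝ) ≤ (n : ℝ) ^ 2 / 2 := by
    have : (2 : ℝ) * Q.card ≤ (n : ℝ) ^ 2 := by exact_mod_cast two_mul_card_filter_lt_le n
    linarith
  have hpow : 0 ≤ (1 - p ^ 2) ^ (n - 2) := pow_nonneg (by nlinarith) _
  have hmul := mul_le_mul_of_nonneg_right hcard hpow
  have hdef : diam2Prob n p = ∑ G : SimpleGraph (Fin n),
      if G.Connected ∧ ∀ u v : Fin n, G.dist u v ≤ 2 then graphWeight p G else 0 := rfl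
  linarith

theorem sq_div_two_mul_pow_le_exp {n : ℕ} (hn : 2 ≤ n) {p : ℝ} (h0 : 0 ≤ p) (h1 : p ≤ 1) :
    (n : ℝ) ^ 2 / 2 * (1 - p ^ 2) ^ (n - 2) ≤
      Real.exp (2 * Real.log n - n * p ^ 2 - Real.log 2 + 2 * p ^ 2) := by
  have hn0 : (0 : ℝ) < n := by exact_mod_cast (by omega : 0 < n)
  have hexp : Real.exp (2 * Real.log n - n * p ^ 2 - Real.log 2 + 2 * p ^ 2) =
      (n : ℝ) ^ 2 / 2 * Real.exp (-p ^ 2) ^ (n - 2) := by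
    have hsplit : 2 * Real.log n - n * p ^ 2 - Real.log 2 + 2 * p ^ 2 =
        Real.log n + Real.log n - Real.log 2 + ((n - 2 : ℕ) : ℝ) * (-p ^ 2) := by
      push_cast [hn]
      ring
    rw [hsplit, Real.exp_add, Real.exp_sub, Real.exp_add, Real.exp_log hn0,
      Real.exp_log two_pos, Real.exp_nat_mul, sq (n : ℝ)]
  rw [hexp]
  have hbase : 0 ≤ 1 - p ^ 2 := by nlinarith
  gcongr
  exact Real.one_sub_le_exp_neg _

/-- If `p(n) → 0` and `2 log n - n p(n)² - log 2 → c < 0`, then for every `ε > 0`, for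
all large `n`, `P(n,p(n)) ≥ (1-ε)(1 - e^{c})`. -/
theorem diam2Prob_lower_critical (p : ℕ → ℝ) (hp : ∀ n, p n ∈ Set.Ioo (0 : ℝ) 1)
    (hp0 : Filter.Tendsto p Filter.atTop (nhds 0)) (c : ℝ) (hc : c < 0)
    (hconv : Filter.Tendsto
      (fun n : ℕ => 2 * Real.log n - n * (p n) ^ 2 - Real.log 2) Filter.atTop (nhds c)) :
    ∀ ε > (0 : ℝ), ∃ N : ℕ, ∀ n ≥ N,
      (1 - ε) * (1 - Real.exp c) ≤ diam2Prob n (p n) := by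
  intro ε hε
  have hlim : Filter.Tendsto (fun n : ℕ => 1 - Real.exp
      (2 * Real.log n - n * (p n) ^ 2 - Real.log 2 + 2 * (p n) ^ 2))
      Filter.atTop (nhds (1 - Real.exp c)) := by
    have h := ((hconv.add ((hp0.pow 2).const_mul 2)).rexp).const_sub 1
    simpa using h
  have hlt : (1 - ε) * (1 - Real.exp c) < 1 - Real.exp c := by
    nlinarith [Real.exp_lt_one_iff.mpr hc]
  obtain ⟨N, hN⟩ := Filter.eventually_atTop.mp (hlim.eventually_const_lt hlt)
  refine ⟨max N 2, fun n hn => ?_⟩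
  have hn2 : 2 ≤ n := le_of_max_le_right hn
  have h0 := (hp n).1.le
  have h1 := (hp n).2.le
  linarith [hN n (le_of_max_le_left hn), one_sub_le_diam2Prob (by omega : 0 < n) h0 h1,
    sq_div_two_mul_pow_le_exp hn2 h0 h1]
end

section
/- Fix k ≥ 3, let n ≥ k+2, and let n₁ ≤ n₂ ≤ … ≤ n_k be positive integers with n_{k−1} ≥ 2 and n₁ + ⋯ + n_k = n. Then for every p ∈ (0,1), the probability P_k(n₁,…,n_k; p) that a random k-partite graph with these partite set sizes and edge probability p has diameter at most 2 satisfies P_k(n₁,…,n_k; p) ≤ (2/(n_k(n_k−1)(1−p²)^{n−n_k})) · (1 + 2n_{k−1}(1−p²)^{−n_{k−1}}(1−p)/(n_k−1))^{−1} + 3k³(1 + p³/(1−p))^{n−n_k}(1−p²)^{−2}/(n_{k−1}−1). -/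
open scoped Classical

/-- The number of unordered pairs of vertices lying in two different partite sets, for a
`k`-partite vertex set with part sizes `sz 0, …, sz (k-1)`. -/
def crossPairs (k : ℕ) (sz : Fin k → ℕ) : ℕ :=
  ∑ i : Fin k, ∑ j : Fin k, if i < j then sz i * sz j else 0

/-- The probability that a random `k`-partite graph — with partite sets of sizes
`sz 0, …, sz (k-1)`, in which each pair of vertices lying in two different partite sets
is joined by an edge independently with probability `p` — is connected with diameter at
most `2`. -/
noncomputable def kpartiteDiam2Prob (k : ℕ) (sz : Fin k → ℕ) (p : ℝ) : ℝ :=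
  ∑ G : SimpleGraph (Σ i : Fin k, Fin (sz i)),
    if (∀ u v : (Σ i : Fin k, Fin (sz i)), G.Adj u v → u.1 ≠ v.1) ∧
        G.Connected ∧ ∀ u v : (Σ i : Fin k, Fin (sz i)), G.dist u v ≤ 2 then
      p ^ Nat.card G.edgeSet * (1 - p) ^ (crossPairs k sz - Nat.card G.edgeSet)
    else 0

namespace KPartiteDiam2

section Weights

variable {V : Type*} [Fintype V] [DecidableEq V]

/-- The real-valued indicator of a Boolean. -/
def ind (b : Bool) : ℝ := if b then 1 else 0

/-- The probability of the row `r` when its entries are independent and the entry at `v` is true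
with probability `π v`. -/
def rowWeight (π : V → ℝ) (r : V → Bool) : ℝ := ∏ v, if r v then π v else 1 - π v

/-- The probability of the Boolean matrix `ω` with independent entries, true with probabilities
given by `P`. -/
def weight (P : V → V → ℝ) (ω : V → V → Bool) : ℝ := ∏ w, rowWeight (P w) (ω w)

/-- The indicator of the event that in no row `w` of `ω` all entries in `e.erase w` are true. For a
pair `e` of vertices this says that `e` is not an edge and has no common neighbour. -/
noncomputable def bad (e : Finset V) (ω : V → V → Bool) : ℝ :=
  ∏ w, (1 - ∏ v ∈ e.erase w, ind (ω w v))

/-- The expectation of `bad e`. -/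
noncomputable def badProb (P : V → V → ℝ) (e : Finset V) : ℝ :=
  ∏ w, (1 - ∏ v ∈ e.erase w, P w v)

/-- The expectation of `bad e * bad f`. -/
noncomputable def jointProb (P : V → V → ℝ) (e f : Finset V) : ℝ :=
  ∏ w, (1 - ∏ v ∈ e.erase w, P w v - ∏ v ∈ f.erase w, P w v +
    ∏ v ∈ e.erase w ∪ f.erase w, P w v)

lemma sum_rowWeight_mul_prod (π : V → ℝ) (S : Finset V) :
    ∑ r : V → Bool, rowWeight π r * ∏ v ∈ S, ind (r v) = ∏ v ∈ S, π v := by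
  have h : ∀ r : V → Bool, rowWeight π r * ∏ v ∈ S, ind (r v) =
      ∏ v, ((if r v then π v else 1 - π v) * if v ∈ S then ind (r v) else 1) := by
    intro r
    rw [Finset.prod_mul_distrib, Finset.prod_ite_mem, Finset.univ_inter, rowWeight]
  have h' := Finset.prod_univ_sum (fun _ : V => (Finset.univ : Finset Bool))
    (fun v b => (if b then π v else 1 - π v) * if v ∈ S then ind b else 1)
  rw [Fintype.piFinset_univ] at h'
  rw [Finset.sum_congr rfl fun r _ => h r, ← h', ← Finset.univ_inter S, ← Finset.prod_ite_mem]
  refine Finset.prod_congr rfl fun v _ => ?_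
  by_cases hv : v ∈ S <;> simp [hv, ind]

lemma sum_rowWeight (π : V → ℝ) : ∑ r : V → Bool, rowWeight π r = 1 := by
  simpa using sum_rowWeight_mul_prod π ∅

lemma sum_weight_mul_prod (P : V → V → ℝ) (g : V → (V → Bool) → ℝ) :
    ∑ ω : V → V → Bool, weight P ω * ∏ w, g w (ω w) =
      ∏ w, ∑ r : V → Bool, rowWeight (P w) r * g w r := by
  have h' := Finset.prod_univ_sum (fun _ : V => (Finset.univ : Finset (V → Bool)))
    (fun w r => rowWeight (P w) r * g w r)
  rw [Fintype.piFinset_univ] at h'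
  rw [h']
  refine Finset.sum_congr rfl fun ω _ => ?_
  rw [weight, Finset.prod_mul_distrib]

lemma sum_weight (P : V → V → ℝ) : ∑ ω : V → V → Bool, weight P ω = 1 := by
  have h := sum_weight_mul_prod P (fun _ _ => 1)
  simpa [sum_rowWeight] using h

lemma weight_nonneg {P : V → V → ℝ} (h0 : ∀ w v, 0 ≤ P w v) (h1 : ∀ w v, P w v ≤ 1)
    (ω : V → V → Bool) : 0 ≤ weight P ω := by
  refine Finset.prod_nonneg fun w _ => Finset.prod_nonneg fun v _ => ?_
  split_ifs
  · exact h0 w v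
  · linarith [h1 w v]

lemma sum_weight_mul_bad (P : V → V → ℝ) (e : Finset V) :
    ∑ ω : V → V → Bool, weight P ω * bad e ω = badProb P e := by
  unfold bad badProb
  rw [sum_weight_mul_prod P (fun w r => 1 - ∏ v ∈ e.erase w, ind (r v))]
  refine Finset.prod_congr rfl fun w _ => ?_
  simp only [mul_sub, mul_one, Finset.sum_sub_distrib, sum_rowWeight, sum_rowWeight_mul_prod]

lemma ind_mul_self (b : Bool) : ind b * ind b = ind b := by cases b <;> simp [ind]

lemma prod_ind_mul_prod_ind (r : V → Bool) (S T : Finset V) :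
    (∏ v ∈ S, ind (r v)) * ∏ v ∈ T, ind (r v) = ∏ v ∈ S ∪ T, ind (r v) := by
  rw [← Finset.univ_inter S, ← Finset.univ_inter T, ← Finset.univ_inter (_ ∪ _),
    ← Finset.prod_ite_mem, ← Finset.prod_ite_mem, ← Finset.prod_ite_mem, ← Finset.prod_mul_distrib]
  refine Finset.prod_congr rfl fun v _ => ?_
  by_cases hS : v ∈ S <;> by_cases hT : v ∈ T <;> simp [hS, hT, ind_mul_self]

lemma sum_weight_mul_bad_mul_bad (P : V → V → ℝ) (e f : Finset V) :
    ∑ ω : V → V → Bool, weight P ω * (bad e ω * bad f ω) = jointProb P e f := by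
  have h : ∀ ω : V → V → Bool, bad e ω * bad f ω =
      ∏ w, (1 - ∏ v ∈ e.erase w, ind (ω w v) - ∏ v ∈ f.erase w, ind (ω w v) +
        ∏ v ∈ e.erase w ∪ f.erase w, ind (ω w v)) := by
    intro ω
    rw [bad, bad, ← Finset.prod_mul_distrib]
    refine Finset.prod_congr rfl fun w _ => ?_
    rw [← prod_ind_mul_prod_ind (ω w)]
    ring
  simp only [h]
  rw [sum_weight_mul_prod P (fun w r => 1 - ∏ v ∈ e.erase w, ind (r v) -
    ∏ v ∈ f.erase w, ind (r v) + ∏ v ∈ e.erase w ∪ f.erase w, ind (r v))]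
  refine Finset.prod_congr rfl fun w _ => ?_
  simp only [mul_sub, mul_add, mul_one, Finset.sum_sub_distrib, Finset.sum_add_distrib,
    sum_rowWeight, sum_rowWeight_mul_prod]

lemma bad_eq_zero {e : Finset V} {ω : V → V → Bool} (w : V)
    (h : ∀ v ∈ e, v ≠ w → ω w v = true) : bad e ω = 0 := by
  refine Finset.prod_eq_zero (Finset.mem_univ w) (sub_eq_zero.2 (Finset.prod_eq_one ?_).symm)
  intro v hv
  rw [h v (Finset.mem_of_mem_erase hv) (Finset.ne_of_mem_erase hv)]
  simp [ind]

lemma jointProb_self (P : V → V → ℝ) (e : Finset V) : jointProb P e e = badProb P e := by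
  refine Finset.prod_congr rfl fun w _ => ?_
  rw [Finset.union_self]
  ring

lemma jointProb_of_disjoint (P : V → V → ℝ) {e f : Finset V} (h : Disjoint e f) :
    jointProb P e f = badProb P e * badProb P f := by
  rw [badProb, badProb, ← Finset.prod_mul_distrib]
  refine Finset.prod_congr rfl fun w _ => ?_
  rw [Finset.prod_union (h.mono (Finset.erase_subset _ _) (Finset.erase_subset _ _))]
  ring

lemma badProb_nonneg {P : V → V → ℝ} (h0 : ∀ w v, 0 ≤ P w v) (h1 : ∀ w v, P w v ≤ 1)
    (e : Finset V) : 0 ≤ badProb P e :=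
  Finset.prod_nonneg fun w _ => sub_nonneg.2
    (Finset.prod_le_one (fun v _ => h0 w v) fun v _ => h1 w v)

/-- Chebyshev's inequality for the event that a sum of random variables vanishes termwise. -/
lemma sum_weight_all_zero_le {Ω ι : Type*} [Fintype Ω] {W : Ω → ℝ} (hW : ∀ ω, 0 ≤ W ω)
    (hW1 : ∑ ω, W ω = 1) (D : Finset ι) (B : ι → Ω → ℝ)
    [∀ ω, Decidable (∀ e ∈ D, B e ω = 0)] {E Y : ℝ} (hE : 0 < E)
    (hmean : ∑ e ∈ D, ∑ ω, W ω * B e ω = E)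
    (hsq : ∑ e ∈ D, ∑ f ∈ D, ∑ ω, W ω * (B e ω * B f ω) ≤ E ^ 2 + Y) :
    ∑ ω, (if ∀ e ∈ D, B e ω = 0 then W ω else 0) ≤ Y / E ^ 2 := by
  rw [le_div_iff₀ (by positivity), Finset.sum_mul]
  have hpt : ∀ ω, (if ∀ e ∈ D, B e ω = 0 then W ω else 0) * E ^ 2 ≤
      W ω * (∑ e ∈ D, B e ω - E) ^ 2 := by
    intro ω
    split_ifs with h
    · rw [Finset.sum_eq_zero h]
      simp
    · rw [zero_mul]
      exact mul_nonneg (hW ω) (sq_nonneg _)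
  refine (Finset.sum_le_sum fun ω _ => hpt ω).trans ?_
  have h1 : ∑ ω, W ω * ∑ e ∈ D, B e ω = E := by
    rw [← hmean, Finset.sum_comm]
    simp only [Finset.mul_sum]
  have h2 : ∑ ω, W ω * (∑ e ∈ D, B e ω) ^ 2 =
      ∑ e ∈ D, ∑ f ∈ D, ∑ ω, W ω * (B e ω * B f ω) := by
    rw [Finset.sum_congr rfl fun e _ => Finset.sum_comm, Finset.sum_comm]
    refine Finset.sum_congr rfl fun ω _ => ?_
    rw [sq, Finset.sum_mul_sum, Finset.mul_sum]
    exact Finset.sum_congr rfl fun e _ => by rw [Finset.mul_sum]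
  have h3 : ∑ ω, W ω * (∑ e ∈ D, B e ω - E) ^ 2 =
      ∑ ω, W ω * (∑ e ∈ D, B e ω) ^ 2 - 2 * E * ∑ ω, W ω * ∑ e ∈ D, B e ω +
        E ^ 2 * ∑ ω, W ω := by
    rw [Finset.mul_sum, Finset.mul_sum, ← Finset.sum_sub_distrib, ← Finset.sum_add_distrib]
    exact Finset.sum_congr rfl fun ω _ => by ring
  rw [h3, h1, h2, hW1]
  linarith

/-- Second moment bound for bad pairs when intersecting pairs have correlation ratio at most `C`
and each vertex carries at most a fraction `δ` of the mean. -/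
lemma sum_weight_no_bad_le {P : V → V → ℝ} (h0 : ∀ w v, 0 ≤ P w v) (h1 : ∀ w v, P w v ≤ 1)
    (D : Finset (Finset V)) (hD : ∀ e ∈ D, e.card = 2) {C δ E : ℝ} (hC : 0 ≤ C) (hE : 0 < E)
    (hmean : ∑ e ∈ D, badProb P e = E)
    (hjoint : ∀ e ∈ D, ∀ f ∈ D, e ≠ f → ¬ Disjoint e f →
      jointProb P e f ≤ C * (badProb P e * badProb P f))
    (hdeg : ∀ a, ∑ e ∈ D with a ∈ e, badProb P e ≤ δ * E) :
    ∑ ω, (if ∀ e ∈ D, bad e ω = 0 then weight P ω else 0) ≤ 1 / E + 2 * C * δ := by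
  have hβ := badProb_nonneg h0 h1
  set d : V → ℝ := fun a => ∑ e ∈ D with a ∈ e, badProb P e with hd
  have hd0 : ∀ a, 0 ≤ d a := fun a => Finset.sum_nonneg fun e _ => hβ e
  have hdsum : ∑ a, d a = 2 * E := by
    simp only [hd, Finset.sum_filter]
    rw [Finset.sum_comm, ← hmean, Finset.mul_sum]
    refine Finset.sum_congr rfl fun e he => ?_
    rw [← Finset.sum_filter, Finset.filter_univ_mem, Finset.sum_const, hD e he]
    simp
  have hpair : ∀ e ∈ D, ∀ f ∈ D, jointProb P e f ≤
      badProb P e * badProb P f + (if e = f then badProb P e else 0) +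
        ∑ a, C * ((if a ∈ e then badProb P e else 0) * (if a ∈ f then badProb P f else 0)) := by
    intro e he f hf
    have hnn : ∀ a, 0 ≤ C * ((if a ∈ e then badProb P e else 0) *
        (if a ∈ f then badProb P f else 0)) := by
      intro a
      refine mul_nonneg hC (mul_nonneg ?_ ?_) <;> split_ifs <;> simp [hβ]
    have hS := Finset.sum_nonneg fun a (_ : a ∈ Finset.univ) => hnn a
    have hprod := mul_nonneg (hβ e) (hβ f)
    by_cases hef : e = f
    · subst hef
      rw [jointProb_self, if_pos rfl]
      linarith
    · rw [if_neg hef]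
      by_cases hdis : Disjoint e f
      · rw [jointProb_of_disjoint P hdis]
        linarith
      · obtain ⟨a, hae, haf⟩ := Finset.not_disjoint_iff.1 hdis
        have hle := Finset.single_le_sum (fun a _ => hnn a) (Finset.mem_univ a)
        simp only [if_pos hae, if_pos haf] at hle
        linarith [hjoint e he f hf hef hdis]
  have hsq : ∑ e ∈ D, ∑ f ∈ D, ∑ ω, weight P ω * (bad e ω * bad f ω) ≤
      E ^ 2 + (E + C * (2 * δ * E ^ 2)) := by
    simp only [sum_weight_mul_bad_mul_bad]
    refine (Finset.sum_le_sum fun e he => Finset.sum_le_sum fun f hf => hpair e he f hf).trans ?_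
    simp only [Finset.sum_add_distrib]
    have e1 : ∑ e ∈ D, ∑ f ∈ D, badProb P e * badProb P f = E ^ 2 := by
      rw [← Finset.sum_mul_sum, hmean, sq]
    have e2 : ∑ e ∈ D, ∑ f ∈ D, (if e = f then badProb P e else 0) = E := by
      rw [← hmean]
      exact Finset.sum_congr rfl fun e he => by rw [Finset.sum_ite_eq, if_pos he]
    have e3 : ∑ e ∈ D, ∑ f ∈ D, ∑ a, C * ((if a ∈ e then badProb P e else 0) *
        (if a ∈ f then badProb P f else 0)) = C * ∑ a, d a * d a := by
      rw [Finset.sum_congr rfl fun e _ => Finset.sum_comm, Finset.sum_comm, Finset.mul_sum]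
      refine Finset.sum_congr rfl fun a _ => ?_
      simp only [hd, Finset.sum_filter]
      rw [Finset.sum_mul_sum, Finset.mul_sum]
      exact Finset.sum_congr rfl fun e _ => by rw [Finset.mul_sum]
    have e4 : ∑ a, d a * d a ≤ 2 * δ * E ^ 2 := by
      calc ∑ a, d a * d a ≤ ∑ a, δ * E * d a :=
            Finset.sum_le_sum fun a _ => mul_le_mul_of_nonneg_right (hdeg a) (hd0 a)
        _ = 2 * δ * E ^ 2 := by rw [← Finset.mul_sum, hdsum]; ring
    rw [e1, e2, e3]
    have := mul_le_mul_of_nonneg_left e4 hC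
    linarith
  refine (sum_weight_all_zero_le (weight_nonneg h0 h1) (sum_weight P) D bad hE
    (by simpa only [sum_weight_mul_bad] using hmean) hsq).trans_eq ?_
  field_simp

end Weights

section Pairs

variable {V : Type*} [DecidableEq V] {K M : Finset V}

/-- The pairs inside `K` together with the pairs between `K` and `M`. -/
noncomputable def pairs (K M : Finset V) : Finset (Finset V) :=
  K.powersetCard 2 ∪ (K ×ˢ M).image fun x => {x.1, x.2}

lemma card_of_mem_pairs (hKM : Disjoint K M) {e : Finset V} (he : e ∈ pairs K M) :
    e.card = 2 := by
  rcases Finset.mem_union.1 he with h | h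
  · exact (Finset.mem_powersetCard.1 h).2
  · obtain ⟨⟨u, v⟩, huv, rfl⟩ := Finset.mem_image.1 h
    rw [Finset.mem_product] at huv
    exact Finset.card_pair (Finset.disjoint_iff_ne.1 hKM u huv.1 v huv.2)

lemma disjoint_pairs (hKM : Disjoint K M) :
    Disjoint (K.powersetCard 2) ((K ×ˢ M).image fun x => ({x.1, x.2} : Finset V)) := by
  rw [Finset.disjoint_left]
  intro e he he'
  obtain ⟨⟨u, v⟩, huv, rfl⟩ := Finset.mem_image.1 he'
  rw [Finset.mem_product] at huv
  exact Finset.disjoint_right.1 hKM huv.2 ((Finset.mem_powersetCard.1 he).1 (by simp))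

lemma card_image_pairs (hKM : Disjoint K M) :
    ((K ×ˢ M).image fun x => ({x.1, x.2} : Finset V)).card = K.card * M.card := by
  rw [Finset.card_image_of_injOn, Finset.card_product]
  rintro ⟨u, v⟩ h ⟨u', v'⟩ h' heq
  simp only [Finset.coe_product, Set.mem_prod, Finset.mem_coe] at h h'
  have hd := Finset.disjoint_left.1 hKM
  replace heq : ({u, v} : Finset V) = {u', v'} := heq
  have h1 : u ∈ ({u', v'} : Finset V) := by
    have : u ∈ ({u, v} : Finset V) := by simp
    exact heq ▸ this
  have h2 : v ∈ ({u', v'} : Finset V) := by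
    have : v ∈ ({u, v} : Finset V) := by simp
    exact heq ▸ this
  simp only [Finset.mem_insert, Finset.mem_singleton] at h1 h2
  grind

lemma card_powersetCard_filter_mem_le (a : V) :
    ((K.powersetCard 2).filter fun e => a ∈ e).card ≤ if a ∈ K then K.card - 1 else 0 := by
  split_ifs with ha
  · rw [← Finset.card_erase_of_mem ha]
    refine (Finset.card_le_card (t := (K.erase a).image fun b => {a, b}) ?_).trans
      Finset.card_image_le
    intro e he
    obtain ⟨he, hae⟩ := Finset.mem_filter.1 he
    obtain ⟨heK, hc⟩ := Finset.mem_powersetCard.1 he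
    have hc' : (e.erase a).card = 1 := by rw [Finset.card_erase_of_mem hae, hc]
    obtain ⟨b, hb⟩ := Finset.card_eq_one.1 hc'
    have hbe : b ∈ e.erase a := by simp [hb]
    refine Finset.mem_image.2 ⟨b, Finset.erase_subset_erase a heK hbe, ?_⟩
    rw [← Finset.insert_erase hae, hb]
  · rw [Nat.le_zero, Finset.card_eq_zero, Finset.filter_eq_empty_iff]
    exact fun e he hae => ha ((Finset.mem_powersetCard.1 he).1 hae)

lemma card_image_filter_mem_le (hKM : Disjoint K M) (hle : M.card ≤ K.card) (a : V) :
    (((K ×ˢ M).image fun x => ({x.1, x.2} : Finset V)).filter fun e => a ∈ e).card ≤ K.card := by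
  by_cases ha : a ∈ K
  · refine le_trans ((Finset.card_le_card (t := M.image fun b => {a, b}) ?_).trans
      Finset.card_image_le) hle
    intro e he
    obtain ⟨he, hae⟩ := Finset.mem_filter.1 he
    obtain ⟨⟨u, v⟩, huv, rfl⟩ := Finset.mem_image.1 he
    rw [Finset.mem_product] at huv
    have hav : a ≠ v := by rintro rfl; exact Finset.disjoint_left.1 hKM ha huv.2
    have hau : a = u := by simpa [hav] using hae
    subst hau
    exact Finset.mem_image.2 ⟨v, huv.2, rfl⟩
  · refine (Finset.card_le_card (t := K.image fun b => {b, a}) ?_).trans Finset.card_image_le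
    intro e he
    obtain ⟨he, hae⟩ := Finset.mem_filter.1 he
    obtain ⟨⟨u, v⟩, huv, rfl⟩ := Finset.mem_image.1 he
    rw [Finset.mem_product] at huv
    have hau : a ≠ u := by rintro rfl; exact ha huv.1
    have hav : a = v := by simpa [hau] using hae
    subst hav
    exact Finset.mem_image.2 ⟨u, huv.1, rfl⟩

end Pairs

section TwoParts

variable {V : Type*} [Fintype V] [DecidableEq V] {P : V → V → ℝ} {p : ℝ} {K M : Finset V}

lemma factor_le {p x y z : ℝ} (hp0 : 0 < p) (hp1 : p < 1) (hx : x = 0 ∨ x = p)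
    (hy : y = 0 ∨ y = p) (hz : z = 0 ∨ z = p) :
    1 - x * y - x * z + x * y * z ≤
      (1 + p ^ 3 / (1 - p)) * ((1 - x * y) * (1 - x * z)) := by
  have hq : 0 < 1 - p := by linarith
  have hR : 0 ≤ p ^ 3 / (1 - p) := by positivity
  have hpp : 0 < 1 - p ^ 2 := by nlinarith
  rcases hx with hx | hx
  · subst hx
    simpa using hR
  rcases hy with hy | hy <;> rcases hz with hz | hz <;> rw [hx, hy, hz]
  · nlinarith
  · nlinarith
  · nlinarith
  have key : (1 + p ^ 3 / (1 - p)) * ((1 - p * p) * (1 - p * p)) =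
      (1 - p + p ^ 3) * (1 - p) * (1 + p) ^ 2 := by
    field_simp
    ring
  rw [key]
  have : 0 ≤ (1 - p) * (2 * p ^ 4 + p ^ 5) := by positivity
  nlinarith

lemma jointProb_pair_le (hp0 : 0 < p) (hp1 : p < 1) (hP : ∀ w v, P w v = 0 ∨ P w v = p)
    (hK0 : ∀ w ∈ K, ∀ v, P w v = 0) {a b c : V} (hab : a ≠ b) (hac : a ≠ c) (hbc : b ≠ c) :
    jointProb P {a, b} {a, c} ≤
      ((1 + p ^ 3 / (1 - p)) ^ Kᶜ.card * ((1 - p ^ 2)⁻¹) ^ 2) *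
        (badProb P {a, b} * badProb P {a, c}) := by
  have hq : 0 < 1 - p := by linarith
  have hR : 0 ≤ p ^ 3 / (1 - p) := by positivity
  have hpp : 0 < 1 - p ^ 2 := by nlinarith
  have hpp1 : 1 ≤ (1 - p ^ 2)⁻¹ := (one_le_inv₀ hpp).2 (by nlinarith)
  have h0 : ∀ w v, 0 ≤ P w v := fun w v => by rcases hP w v with h | h <;> rw [h]; exact hp0.le
  have h1 : ∀ w v, P w v ≤ 1 := fun w v => by
    rcases hP w v with h | h <;> rw [h]
    · exact zero_le_one
    · exact hp1.le
  set R := 1 + p ^ 3 / (1 - p) with hRdef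
  have hR1 : 1 ≤ R := by linarith
  set Q := (1 - p ^ 2)⁻¹ with hQ
  have hC : R ^ Kᶜ.card * Q ^ 2 =
      ∏ w, (if w ∈ K then 1 else R) * (if w ∈ ({b, c} : Finset V) then Q else 1) := by
    rw [Finset.prod_mul_distrib, Finset.prod_ite_mem, Finset.univ_inter, Finset.prod_const,
      Finset.card_pair hbc, Finset.prod_ite, Finset.prod_const_one, one_mul, Finset.prod_const]
    congr 3
    ext w
    simp
  rw [hC, badProb, badProb, ← Finset.prod_mul_distrib, ← Finset.prod_mul_distrib]
  -- the row of an endpoint outside the common vertex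
  have hend : ∀ x y : V, ∀ s : ℝ, 1 ≤ s → ∀ w, 1 - P w x - P w x * P w y + P w x * P w y ≤
      s * Q * ((1 - P w x) * (1 - P w x * P w y)) := by
    intro x y s hs w
    have hxy : P w x * P w y ≤ p ^ 2 := by
      rcases hP w x with h | h <;> rcases hP w y with h' | h' <;> rw [h, h'] <;> nlinarith
    have h2 : 1 ≤ s * Q * (1 - P w x * P w y) := by
      calc (1 : ℝ) = 1 * (Q * (1 - p ^ 2)) := by rw [hQ, inv_mul_cancel₀ hpp.ne', one_mul]
        _ ≤ s * (Q * (1 - P w x * P w y)) := by gcongr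
        _ = _ := by ring
    have h3 := mul_le_mul_of_nonneg_left h2 (sub_nonneg.2 (h1 w x))
    linarith
  refine Finset.prod_le_prod (fun w _ => ?_) fun w _ => ?_
  · have hS : ∀ S : Finset V, 0 ≤ ∏ v ∈ S, P w v := fun S => Finset.prod_nonneg fun v _ => h0 w v
    have hS1 : ∀ S : Finset V, ∏ v ∈ S, P w v ≤ 1 := fun S =>
      Finset.prod_le_one (fun v _ => h0 w v) fun v _ => h1 w v
    have hui := Finset.prod_union_inter (f := P w)
      (s₁ := ({a, b} : Finset V).erase w) (s₂ := ({a, c} : Finset V).erase w)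
    set S := ({a, b} : Finset V).erase w
    set T := ({a, c} : Finset V).erase w
    nlinarith [hS (S ∪ T), hS1 (S ∩ T), mul_nonneg (sub_nonneg.2 (hS1 S)) (sub_nonneg.2 (hS1 T)),
      mul_nonneg (hS (S ∪ T)) (sub_nonneg.2 (hS1 (S ∩ T)))]
  · have hs : (1 : ℝ) ≤ if w ∈ K then 1 else R := by split_ifs <;> [exact le_rfl; exact hR1]
    by_cases hwb : w = b
    · subst hwb
      have e1 : ({a, w} : Finset V).erase w = {a} := by ext v; simp; grind
      have e2 : ({a, c} : Finset V).erase w = {a, c} := by ext v; simp; grind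
      have e3 : ({a} ∪ {a, c} : Finset V) = {a, c} := by ext v; simp
      rw [e1, e2, e3, Finset.prod_singleton, Finset.prod_pair hac, if_pos (show w ∈ ({w, c} : Finset V) by simp)]
      exact hend a c _ hs w
    by_cases hwc : w = c
    · subst hwc
      have e1 : ({a, w} : Finset V).erase w = {a} := by ext v; simp; grind
      have e2 : ({a, b} : Finset V).erase w = {a, b} := by ext v; simp; grind
      have e3 : ({a, b} ∪ {a} : Finset V) = {a, b} := by ext v; simp; grind
      rw [e1, e2, e3, Finset.prod_singleton, Finset.prod_pair hab, if_pos (show w ∈ ({b, w} : Finset V) by simp)]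
      linarith [hend a b _ hs w]
    rw [if_neg (show w ∉ ({b, c} : Finset V) by simp [hwb, hwc]), mul_one]
    by_cases hwa : w = a
    · subst hwa
      have e1 : ({w, b} : Finset V).erase w = {b} := by ext v; simp; grind
      have e2 : ({w, c} : Finset V).erase w = {c} := by ext v; simp; grind
      rw [e1, e2, Finset.prod_union (by simpa using hbc), Finset.prod_singleton,
        Finset.prod_singleton]
      have := mul_nonneg (sub_nonneg.2 (h1 w b)) (sub_nonneg.2 (h1 w c))
      nlinarith
    have e1 : ({a, b} : Finset V).erase w = {a, b} := by ext v; simp; grind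
    have e2 : ({a, c} : Finset V).erase w = {a, c} := by ext v; simp; grind
    have e3 : ({a, b} ∪ {a, c} : Finset V) = {a, b, c} := by ext v; simp
    rw [e1, e2, e3, Finset.prod_pair hab, Finset.prod_pair hac,
      Finset.prod_insert (by simp [hab, hac]), Finset.prod_pair hbc, ← mul_assoc]
    split_ifs with hwK
    · simp [hK0 w hwK]
    · exact factor_le hp0 hp1 (hP w a) (hP w b) (hP w c)

lemma badProb_pair_of_mem_of_mem (hK0 : ∀ w ∈ K, ∀ v, P w v = 0)
    (hKp : ∀ w, w ∉ K → ∀ u ∈ K, P w u = p) {u u' : V} (hu : u ∈ K) (hu' : u' ∈ K)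
    (h : u ≠ u') : badProb P {u, u'} = (1 - p ^ 2) ^ Kᶜ.card := by
  rw [badProb, ← Finset.prod_const, ← Finset.univ_inter Kᶜ, ← Finset.prod_ite_mem]
  refine Finset.prod_congr rfl fun w _ => ?_
  by_cases hw : w ∈ K
  · have : ∃ v ∈ ({u, u'} : Finset V).erase w, P w v = 0 := by
      by_cases hwu : w = u
      · exact ⟨u', by simp [hwu, h.symm], hK0 w hw _⟩
      · exact ⟨u, by simp [Ne.symm hwu], hK0 w hw _⟩
    obtain ⟨v, hv, hv0⟩ := this
    simp [Finset.prod_eq_zero hv hv0, hw]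
  · have e1 : ({u, u'} : Finset V).erase w = {u, u'} :=
      Finset.erase_eq_of_notMem (by simp; grind)
    rw [e1, Finset.prod_pair h, hKp w hw u hu, hKp w hw u' hu', if_pos (by simpa using hw), sq]

lemma badProb_pair_of_mem_of_mem_prev (hK0 : ∀ w ∈ K, ∀ v, P w v = 0)
    (hKp : ∀ w, w ∉ K → ∀ u ∈ K, P w u = p) (hM0 : ∀ w ∈ M, ∀ v ∈ M, P w v = 0)
    (hMp : ∀ w, w ∉ K → w ∉ M → ∀ v ∈ M, P w v = p) (hKM : Disjoint K M) {u v : V}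
    (hu : u ∈ K) (hv : v ∈ M) : badProb P {u, v} = (1 - p) * (1 - p ^ 2) ^ (K ∪ M)ᶜ.card := by
  have huv : u ≠ v := by rintro rfl; exact Finset.disjoint_left.1 hKM hu hv
  have hvK : v ∉ K := Finset.disjoint_right.1 hKM hv
  have e0 : (1 - p) * (1 - p ^ 2) ^ (K ∪ M)ᶜ.card =
      ∏ w, (if w = v then 1 - p else 1) * (if w ∈ (K ∪ M)ᶜ then 1 - p ^ 2 else 1) := by
    rw [Finset.prod_mul_distrib, Finset.prod_ite_mem, Finset.univ_inter, Finset.prod_const]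
    simp
  rw [e0]
  refine Finset.prod_congr rfl fun w _ => ?_
  by_cases hwv : w = v
  · subst hwv
    have e1 : ({u, w} : Finset V).erase w = {u} := by ext x; simp; grind
    rw [e1, Finset.prod_singleton, hKp w hvK u hu]
    simp [hv]
  by_cases hw : w ∈ K ∪ M
  · have hv' : v ∈ ({u, v} : Finset V).erase w := by simp [Ne.symm hwv]
    have hv0 : P w v = 0 := by
      rcases Finset.mem_union.1 hw with h | h
      · exact hK0 w h v
      · exact hM0 w h v hv
    rw [Finset.prod_eq_zero hv' hv0, if_neg hwv, if_neg (by simpa [or_iff_not_imp_left] using hw)]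
    simp
  · have hw' := hw
    rw [Finset.mem_union, not_or] at hw'
    have e1 : ({u, v} : Finset V).erase w = {u, v} :=
      Finset.erase_eq_of_notMem (by simp; grind)
    rw [e1, Finset.prod_pair huv, hKp w hw'.1 u hu, hMp w hw'.1 hw'.2 v hv, if_neg hwv,
      if_pos (by simpa using hw')]
    ring

/-- Bound on the probability that no pair inside `K` or between `K` and `M` is bad. -/
theorem sum_weight_no_bad_pairs_le (hp0 : 0 < p) (hp1 : p < 1)
    (hP : ∀ w v, P w v = 0 ∨ P w v = p) (hK0 : ∀ w ∈ K, ∀ v, P w v = 0)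
    (hKp : ∀ w, w ∉ K → ∀ u ∈ K, P w u = p) (hM0 : ∀ w ∈ M, ∀ v ∈ M, P w v = 0)
    (hMp : ∀ w, w ∉ K → w ∉ M → ∀ v ∈ M, P w v = p) (hKM : Disjoint K M)
    (hM : 0 < M.card) (hle : M.card ≤ K.card) :
    ∑ ω, (if ∀ e ∈ pairs K M, bad e ω = 0 then weight P ω else 0) ≤
      1 / ((K.card : ℝ) * (K.card - 1) / 2 * (1 - p ^ 2) ^ (Fintype.card V - K.card) +
        (K.card : ℝ) * M.card *
          ((1 - p) * (1 - p ^ 2) ^ (Fintype.card V - (K.card + M.card)))) +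
      2 * ((1 + p ^ 3 / (1 - p)) ^ (Fintype.card V - K.card) * ((1 - p ^ 2)⁻¹) ^ 2) *
        (2 / M.card) := by
  rw [← Finset.card_union_of_disjoint hKM, ← Finset.card_compl, ← Finset.card_compl]
  have hq : 0 < 1 - p := by linarith
  have hpp : 0 < 1 - p ^ 2 := by nlinarith
  have h0 : ∀ w v, 0 ≤ P w v := fun w v => by rcases hP w v with h | h <;> rw [h]; exact hp0.le
  have h1 : ∀ w v, P w v ≤ 1 := fun w v => by
    rcases hP w v with h | h <;> rw [h]
    · exact zero_le_one
    · exact hp1.le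
  have hMr : (0 : ℝ) < M.card := by exact_mod_cast hM
  have hler : (M.card : ℝ) ≤ K.card := by exact_mod_cast hle
  have hK1 : (1 : ℝ) ≤ K.card := by exact_mod_cast hM.trans_le hle
  have hβ1 : ∀ e ∈ K.powersetCard 2, badProb P e = (1 - p ^ 2) ^ Kᶜ.card := by
    intro e he
    obtain ⟨heK, hc⟩ := Finset.mem_powersetCard.1 he
    obtain ⟨u, u', h, rfl⟩ := Finset.card_eq_two.1 hc
    exact badProb_pair_of_mem_of_mem hK0 hKp (heK (by simp)) (heK (by simp)) h
  have hβ2 : ∀ e ∈ (K ×ˢ M).image (fun x => ({x.1, x.2} : Finset V)),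
      badProb P e = (1 - p) * (1 - p ^ 2) ^ (K ∪ M)ᶜ.card := by
    intro e he
    obtain ⟨⟨u, v⟩, huv, rfl⟩ := Finset.mem_image.1 he
    rw [Finset.mem_product] at huv
    exact badProb_pair_of_mem_of_mem_prev hK0 hKp hM0 hMp hKM huv.1 huv.2
  have hα : 0 < (1 - p ^ 2) ^ Kᶜ.card := by positivity
  have hγ : 0 < (1 - p) * (1 - p ^ 2) ^ (K ∪ M)ᶜ.card := by positivity
  set α := (1 - p ^ 2) ^ Kᶜ.card with hαdef
  set γ := (1 - p) * (1 - p ^ 2) ^ (K ∪ M)ᶜ.card with hγdef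
  have hR : 0 ≤ (1 + p ^ 3 / (1 - p)) := by positivity
  refine sum_weight_no_bad_le h0 h1 (pairs K M) (fun e he => card_of_mem_pairs hKM he)
    (by positivity) ?_ ?_ ?_ ?_
  · have : 0 ≤ (K.card : ℝ) * (K.card - 1) / 2 * α := by
      have : 0 ≤ (K.card : ℝ) - 1 := by linarith
      positivity
    have h2 : 0 < (K.card : ℝ) * M.card * γ := by positivity
    linarith
  · rw [pairs, Finset.sum_union (disjoint_pairs hKM), Finset.sum_congr rfl hβ1,
      Finset.sum_congr rfl hβ2, Finset.sum_const, Finset.sum_const, card_image_pairs hKM,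
      Finset.card_powersetCard, nsmul_eq_mul, nsmul_eq_mul, Nat.cast_choose_two, Nat.cast_mul]
  · intro e he f hf hef hdis
    obtain ⟨a, hae, haf⟩ := Finset.not_disjoint_iff.1 hdis
    have hpair : ∀ e ∈ pairs K M, a ∈ e → ∃ b, a ≠ b ∧ e = {a, b} := by
      intro e he hae
      have hc : (e.erase a).card = 1 := by
        rw [Finset.card_erase_of_mem hae, card_of_mem_pairs hKM he]
      obtain ⟨b, hb⟩ := Finset.card_eq_one.1 hc
      have hbe : b ∈ e.erase a := by simp [hb]
      exact ⟨b, (Finset.ne_of_mem_erase hbe).symm, by rw [← Finset.insert_erase hae, hb]⟩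
    obtain ⟨b, hab, rfl⟩ := hpair e he hae
    obtain ⟨c, hac, rfl⟩ := hpair f hf haf
    exact jointProb_pair_le hp0 hp1 hP hK0 hab hac (by rintro rfl; exact hef rfl)
  · intro a
    rw [pairs, Finset.filter_union, Finset.sum_union
      (Finset.disjoint_filter_filter (disjoint_pairs hKM)),
      Finset.sum_congr rfl fun e he => hβ1 e (Finset.mem_filter.1 he).1,
      Finset.sum_congr rfl fun e he => hβ2 e (Finset.mem_filter.1 he).1,
      Finset.sum_const, Finset.sum_const, nsmul_eq_mul, nsmul_eq_mul]
    have c1 : ((((K.powersetCard 2).filter fun e => a ∈ e).card : ℕ) : ℝ) ≤ K.card - 1 := by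
      have h := card_powersetCard_filter_mem_le (K := K) a
      have h' : ((K.powersetCard 2).filter fun e => a ∈ e).card + 1 ≤ K.card := by
        have := hM.trans_le hle
        split_ifs at h <;> omega
      have h'' : ((((K.powersetCard 2).filter fun e => a ∈ e).card : ℕ) : ℝ) + 1 ≤ K.card := by
        exact_mod_cast h'
      linarith
    have c2 : (((((K ×ˢ M).image fun x => ({x.1, x.2} : Finset V)).filter
        fun e => a ∈ e).card : ℕ) : ℝ) ≤ K.card := by
      exact_mod_cast card_image_filter_mem_le hKM hle a
    have r1 : ((K.card : ℝ) - 1) ≤ 2 / M.card * (K.card * (K.card - 1) / 2) := by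
      rw [div_mul_eq_mul_div, le_div_iff₀ hMr]
      nlinarith
    have r2 : (K.card : ℝ) ≤ 2 / M.card * (K.card * M.card) := by
      rw [div_mul_eq_mul_div, le_div_iff₀ hMr]
      nlinarith
    calc _ ≤ 2 / M.card * ((K.card : ℝ) * (K.card - 1) / 2) * α +
          2 / M.card * ((K.card : ℝ) * M.card) * γ :=
          add_le_add (mul_le_mul_of_nonneg_right (c1.trans r1) hα.le)
            (mul_le_mul_of_nonneg_right (c2.trans r2) hγ.le)
      _ = _ := by ring

end TwoParts

section Graphs

variable {k : ℕ} {sz : Fin k → ℕ}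

/-- The edge probabilities of the random `k`-partite graph, each edge being recorded once, with the
endpoint in the earlier part first. -/
def edgeProb (sz : Fin k → ℕ) (p : ℝ) (w v : Σ i : Fin k, Fin (sz i)) : ℝ :=
  if w.1 < v.1 then p else 0

/-- The Boolean matrix recording the edges of a `k`-partite graph, each of them once. -/
noncomputable def edgeMatrix (G : SimpleGraph (Σ i : Fin k, Fin (sz i)))
    (w v : Σ i : Fin k, Fin (sz i)) : Bool :=
  decide (w.1 < v.1 ∧ G.Adj w v)

/-- Every edge joins two different parts. -/
def IsPartite (G : SimpleGraph (Σ i : Fin k, Fin (sz i))) : Prop :=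
  ∀ u v, G.Adj u v → u.1 ≠ v.1

lemma IsPartite.edgeMatrix_injOn :
    Set.InjOn edgeMatrix {G : SimpleGraph (Σ i : Fin k, Fin (sz i)) | IsPartite G} := by
  intro G hG H hH h
  have key : ∀ w v : Σ i : Fin k, Fin (sz i), w.1 < v.1 → (G.Adj w v ↔ H.Adj w v) := by
    intro w v hwv
    have := congrFun (congrFun h w) v
    simpa [edgeMatrix, hwv] using this
  ext w v
  rcases lt_trichotomy w.1 v.1 with hlt | heq | hgt
  · exact key w v hlt
  · exact ⟨fun h => absurd heq (hG w v h), fun h => absurd heq (hH w v h)⟩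
  · rw [G.adj_comm, H.adj_comm, key v w hgt]

lemma IsPartite.card_edgeSet {G : SimpleGraph (Σ i : Fin k, Fin (sz i))} (hG : IsPartite G) :
    Nat.card G.edgeSet = (Finset.univ.filter fun x : (Σ i : Fin k, Fin (sz i)) ×
      (Σ i : Fin k, Fin (sz i)) => x.1.1 < x.2.1 ∧ G.Adj x.1 x.2).card := by
  have himg : G.edgeSet = ((Finset.univ.filter fun x : (Σ i : Fin k, Fin (sz i)) ×
      (Σ i : Fin k, Fin (sz i)) => x.1.1 < x.2.1 ∧ G.Adj x.1 x.2).image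
        fun x => s(x.1, x.2) : Finset _) := by
    ext e
    induction e with
    | _ u v =>
      simp only [SimpleGraph.mem_edgeSet, Finset.coe_image, Set.mem_image, Finset.mem_coe,
        Finset.mem_filter, Finset.mem_univ, true_and]
      constructor
      · intro h
        rcases lt_or_gt_of_ne (hG u v h) with hlt | hgt
        · exact ⟨(u, v), ⟨hlt, h⟩, rfl⟩
        · exact ⟨(v, u), ⟨hgt, h.symm⟩, Sym2.eq_swap⟩
      · rintro ⟨x, ⟨_, hx⟩, he⟩
        rwa [← SimpleGraph.mem_edgeSet, ← he, SimpleGraph.mem_edgeSet]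
  rw [Nat.card_coe_set_eq, himg, Set.ncard_coe_finset, Finset.card_image_of_injOn]
  rintro ⟨u, v⟩ h ⟨u', v'⟩ h' heq
  simp only [Finset.coe_filter, Finset.mem_univ, true_and, Set.mem_ofPred_eq] at h h'
  rcases Sym2.eq_iff.1 heq with ⟨rfl, rfl⟩ | ⟨rfl, rfl⟩
  · rfl
  · exact absurd h.1 h'.1.asymm

lemma card_filter_lt : (Finset.univ.filter fun x : (Σ i : Fin k, Fin (sz i)) ×
    (Σ i : Fin k, Fin (sz i)) => x.1.1 < x.2.1).card = crossPairs k sz := by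
  rw [Finset.card_filter, Fintype.sum_prod_type, Fintype.sum_sigma, crossPairs]
  refine Finset.sum_congr rfl fun i _ => ?_
  simp only [Fintype.sum_sigma]
  trans ∑ _x : Fin (sz i), ∑ j, if i < j then sz j else 0
  · exact Finset.sum_congr rfl fun x _ => Finset.sum_congr rfl fun j _ => by
      by_cases h : i < j <;> simp [h]
  · rw [Finset.sum_const, Finset.card_univ, Fintype.card_fin, smul_eq_mul, Finset.mul_sum]
    refine Finset.sum_congr rfl fun j _ => ?_
    split_ifs <;> simp

lemma IsPartite.weight_edgeMatrix {G : SimpleGraph (Σ i : Fin k, Fin (sz i))} (hG : IsPartite G)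
    (p : ℝ) : weight (edgeProb sz p) (edgeMatrix G) =
      p ^ Nat.card G.edgeSet * (1 - p) ^ (crossPairs k sz - Nat.card G.edgeSet) := by
  have hcard : crossPairs k sz - Nat.card G.edgeSet =
      (Finset.univ.filter fun x : (Σ i : Fin k, Fin (sz i)) × (Σ i : Fin k, Fin (sz i)) =>
        x.1.1 < x.2.1 ∧ ¬ G.Adj x.1 x.2).card := by
    rw [hG.card_edgeSet, ← card_filter_lt, ← Finset.filter_filter, ← Finset.filter_filter]
    have := Finset.card_filter_add_card_filter_not (s := Finset.univ.filter
      fun x : (Σ i : Fin k, Fin (sz i)) × (Σ i : Fin k, Fin (sz i)) => x.1.1 < x.2.1)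
      (fun x => G.Adj x.1 x.2)
    omega
  rw [hcard, hG.card_edgeSet, ← Finset.prod_const, ← Finset.prod_const, Finset.prod_filter,
    Finset.prod_filter, ← Finset.prod_mul_distrib, Fintype.prod_prod_type, weight]
  refine Finset.prod_congr rfl fun w _ => Finset.prod_congr rfl fun v _ => ?_
  by_cases h1 : w.1 < v.1 <;> by_cases h2 : G.Adj w v <;> simp [edgeMatrix, edgeProb, h1, h2]

lemma exists_adj_adj_of_dist_le_two {V : Type*} {G : SimpleGraph V} (hG : G.Connected) {u v : V}
    (huv : u ≠ v) (h : G.dist u v ≤ 2) : G.Adj u v ∨ ∃ w, G.Adj u w ∧ G.Adj w v := by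
  obtain ⟨q, hq⟩ := hG.exists_walk_length_eq_dist u v
  rw [← hq] at h
  match q, h with
  | .nil, _ => exact absurd rfl huv
  | .cons h1 .nil, _ => exact Or.inl h1
  | .cons h1 (.cons h2 .nil), _ => exact Or.inr ⟨_, h1, h2⟩
  | .cons _ (.cons _ (.cons _ _)), h => simp at h

lemma bad_edgeMatrix_eq_zero {G : SimpleGraph (Σ i : Fin k, Fin (sz i))} (hG : IsPartite G)
    (hconn : G.Connected) (hdist : ∀ u v, G.dist u v ≤ 2) {u v : Σ i : Fin k, Fin (sz i)}
    (huv : u ≠ v) (hle : v.1 ≤ u.1) (htop : ∀ i, i ≤ v.1 ∨ u.1 = i)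
    {e : Finset (Σ i : Fin k, Fin (sz i))} (he : ∀ x ∈ e, x = u ∨ x = v) :
    bad e (edgeMatrix G) = 0 := by
  rcases exists_adj_adj_of_dist_le_two hconn huv (hdist u v) with h | ⟨w, h1, h2⟩
  · refine bad_eq_zero v fun x hx hxv => ?_
    obtain rfl := (he x hx).resolve_right hxv
    simp [edgeMatrix, h.symm, lt_of_le_of_ne hle (hG _ _ h.symm)]
  · have hwv : w.1 < v.1 := by
      rcases htop w.1 with h | h
      · exact lt_of_le_of_ne h (hG _ _ h2)
      · exact absurd h (hG _ _ h1)
    refine bad_eq_zero w fun x hx _ => ?_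
    rcases he x hx with rfl | rfl
    · simp [edgeMatrix, h1.symm, hwv.trans_le hle]
    · simp [edgeMatrix, h2, hwv]

/-- The vertices of part `i`. -/
def part (sz : Fin k → ℕ) (i : Fin k) : Finset (Σ i : Fin k, Fin (sz i)) :=
  Finset.univ.filter fun v => v.1 = i

lemma mem_part {i : Fin k} {v : Σ i : Fin k, Fin (sz i)} : v ∈ part sz i ↔ v.1 = i := by
  simp [part]

lemma card_part (i : Fin k) : (part sz i).card = sz i := by
  rw [part, Finset.card_filter, Fintype.sum_sigma, Finset.sum_eq_single i]
  · simp
  · intro j _ hj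
    simp [hj]
  · simp

lemma disjoint_part {i j : Fin k} (h : i ≠ j) : Disjoint (part sz i) (part sz j) := by
  rw [Finset.disjoint_left]
  intro v hi hj
  exact h ((mem_part.1 hi).symm.trans (mem_part.1 hj))

lemma kpartiteDiam2Prob_le_sum {l m : Fin k} (hml : m < l) (htop : ∀ i, i ≤ m ∨ i = l)
    {p : ℝ} (hp0 : 0 ≤ p) (hp1 : p ≤ 1) :
    kpartiteDiam2Prob k sz p ≤ ∑ ω, if ∀ e ∈ pairs (part sz l) (part sz m), bad e ω = 0 then
      weight (edgeProb sz p) ω else 0 := by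
  have hW : ∀ ω, 0 ≤ weight (edgeProb sz p) ω := by
    refine weight_nonneg (fun w v => ?_) fun w v => ?_ <;> unfold edgeProb <;> split_ifs <;>
      linarith
  have hnn : ∀ ω, 0 ≤ if ∀ e ∈ pairs (part sz l) (part sz m), bad e ω = 0 then
      weight (edgeProb sz p) ω else 0 := by
    intro ω
    split_ifs
    exacts [hW ω, le_rfl]
  rw [kpartiteDiam2Prob, ← Finset.sum_filter]
  set S := Finset.univ.filter fun G : SimpleGraph (Σ i : Fin k, Fin (sz i)) =>
    (∀ u v, G.Adj u v → u.1 ≠ v.1) ∧ G.Connected ∧ ∀ u v, G.dist u v ≤ 2 with hS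
  have hmem : ∀ G ∈ S, IsPartite G ∧ G.Connected ∧ ∀ u v, G.dist u v ≤ 2 := fun G hG =>
    (Finset.mem_filter.1 hG).2
  have hterm : ∀ G ∈ S, p ^ Nat.card G.edgeSet * (1 - p) ^ (crossPairs k sz - Nat.card G.edgeSet) =
      if ∀ e ∈ pairs (part sz l) (part sz m), bad e (edgeMatrix G) = 0 then
        weight (edgeProb sz p) (edgeMatrix G) else 0 := by
    intro G hG
    obtain ⟨hpart, hconn, hdist⟩ := hmem G hG
    rw [if_pos, hpart.weight_edgeMatrix]
    intro e he
    rcases Finset.mem_union.1 he with he | he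
    · obtain ⟨heK, hc⟩ := Finset.mem_powersetCard.1 he
      obtain ⟨u, v, huv, rfl⟩ := Finset.card_eq_two.1 hc
      have hu : u.1 = l := mem_part.1 (heK (by simp))
      have hv : v.1 = l := mem_part.1 (heK (by simp))
      refine bad_edgeMatrix_eq_zero (u := u) (v := v) hpart hconn hdist huv (by rw [hu, hv]) (fun i => ?_)
        (by simp)
      rw [hv]
      exact Or.inl ((htop i).elim (fun h => h.trans hml.le) fun h => h.le)
    · obtain ⟨⟨u, v⟩, h, rfl⟩ := Finset.mem_image.1 he
      have hu : u.1 = l := mem_part.1 (Finset.mem_product.1 h).1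
      have hv : v.1 = m := mem_part.1 (Finset.mem_product.1 h).2
      refine bad_edgeMatrix_eq_zero (u := u) (v := v) hpart hconn hdist ?_ (by rw [hu, hv]; exact hml.le)
        (fun i => ?_) (by simp)
      · intro huv
        rw [huv] at hu
        exact hml.ne (hv.symm.trans hu)
      · rw [hu, hv]
        exact (htop i).imp_right Eq.symm
  rw [Finset.sum_congr rfl hterm, ← Finset.sum_image (s := S) (g := edgeMatrix)
    (f := fun ω => if ∀ e ∈ pairs (part sz l) (part sz m), bad e ω = 0 then
      weight (edgeProb sz p) ω else 0)
    fun G hG H hH h => IsPartite.edgeMatrix_injOn (hmem G hG).1 (hmem H hH).1 h]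
  exact Finset.sum_le_sum_of_subset_of_nonneg (Finset.subset_univ _) fun ω _ _ => hnn ω

lemma kpartiteDiam2Prob_le {l m : Fin k} (hml : m < l) (htop : ∀ i, i ≤ m ∨ i = l)
    (hm : 0 < sz m) (hle : sz m ≤ sz l) {p : ℝ} (hp0 : 0 < p) (hp1 : p < 1) :
    kpartiteDiam2Prob k sz p ≤
      1 / ((sz l : ℝ) * (sz l - 1) / 2 * (1 - p ^ 2) ^ (∑ i, sz i - sz l) +
        (sz l : ℝ) * sz m * ((1 - p) * (1 - p ^ 2) ^ (∑ i, sz i - (sz l + sz m)))) +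
      2 * ((1 + p ^ 3 / (1 - p)) ^ (∑ i, sz i - sz l) * ((1 - p ^ 2)⁻¹) ^ 2) * (2 / sz m) := by
  refine (kpartiteDiam2Prob_le_sum hml htop hp0.le hp1.le).trans ?_
  have hdis := disjoint_part (sz := sz) hml.ne'
  have h := sum_weight_no_bad_pairs_le (P := edgeProb sz p) (K := part sz l) (M := part sz m)
    hp0 hp1 ?_ ?_ ?_ ?_ ?_ hdis (by rwa [card_part]) (by rwa [card_part, card_part])
  · simpa only [card_part,
      Fintype.card_sigma, Fintype.card_fin] using h
  · intro w v
    unfold edgeProb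
    split_ifs <;> simp
  · intro w hw v
    rw [mem_part] at hw
    have : ¬ w.1 < v.1 := by
      rw [hw, not_lt]
      exact (htop v.1).elim (fun h => h.trans hml.le) fun h => h.le
    simp [edgeProb, this]
  · intro w hw u hu
    rw [mem_part] at hw hu
    have : w.1 < u.1 := by
      rw [hu]
      exact ((htop w.1).resolve_right hw).trans_lt hml
    simp [edgeProb, this]
  · intro w hw v hv
    rw [mem_part] at hw hv
    simp [edgeProb, hw, hv]
  · intro w hwl hwm v hv
    rw [mem_part] at hwl hwm hv
    have : w.1 < v.1 := by
      rw [hv]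
      exact lt_of_le_of_ne ((htop w.1).resolve_right hwl) hwm
    simp [edgeProb, this]

end Graphs

end KPartiteDiam2

/-- Turán-sieve upper bound for random `k`-partite graphs having diameter at most 2. -/
theorem kpartiteDiam2Prob_upper (k : ℕ) (hk : 3 ≤ k) (sz : Fin k → ℕ)
    (hpos : ∀ i, 0 < sz i) (hmono : Monotone sz)
    (h2 : 2 ≤ sz ⟨k - 2, by omega⟩)
    (n : ℕ) (hn : n = ∑ i, sz i) (hnk : k + 2 ≤ n)
    (p : ℝ) (hp0 : 0 < p) (hp1 : p < 1) :
    kpartiteDiam2Prob k sz p ≤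
      (2 / ((sz ⟨k - 1, by omega⟩ : ℝ) * ((sz ⟨k - 1, by omega⟩ : ℝ) - 1) *
            (1 - p ^ 2) ^ (n - sz ⟨k - 1, by omega⟩))) *
          (1 + 2 * (sz ⟨k - 2, by omega⟩ : ℝ) *
              (1 - p ^ 2) ^ (-(sz ⟨k - 2, by omega⟩ : ℤ)) * (1 - p) /
              ((sz ⟨k - 1, by omega⟩ : ℝ) - 1))⁻¹ +
        3 * (k : ℝ) ^ 3 * (1 + p ^ 3 / (1 - p)) ^ (n - sz ⟨k - 1, by omega⟩) *
            (1 - p ^ 2) ^ (-2 : ℤ) / ((sz ⟨k - 2, by omega⟩ : ℝ) - 1) := by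
  set l : Fin k := ⟨k - 1, by omega⟩ with hl
  set m : Fin k := ⟨k - 2, by omega⟩ with hm
  have hml : m < l := by rw [hl, hm, Fin.mk_lt_mk]; omega
  have htop : ∀ i, i ≤ m ∨ i = l := by
    intro i
    rw [hl, hm, Fin.le_def, Fin.ext_iff]
    have := i.isLt
    simp only
    omega
  have hle : sz m ≤ sz l := hmono hml.le
  have hsum : sz l + sz m ≤ ∑ i, sz i := by
    rw [← Finset.sum_pair hml.ne']
    exact Finset.sum_le_sum_of_subset (Finset.subset_univ _)
  refine (KPartiteDiam2.kpartiteDiam2Prob_le hml htop (hpos m) hle hp0 hp1).trans ?_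
  rw [← hn] at hsum ⊢
  have hq : 0 < 1 - p := by linarith
  have hpp : 0 < 1 - p ^ 2 := by nlinarith
  have hM : (2 : ℝ) ≤ sz m := by exact_mod_cast h2
  have hN : (2 : ℝ) ≤ sz l := hM.trans (by exact_mod_cast hle)
  refine add_le_add (le_of_eq ?_) ?_
  · have hpow : (1 - p ^ 2) ^ (n - sz l) = (1 - p ^ 2) ^ (n - (sz l + sz m)) *
        (1 - p ^ 2) ^ sz m := by
      rw [← pow_add]
      congr 1
      omega
    have hN1 : 0 < (sz l : ℝ) - 1 := by linarith
    rw [hpow, zpow_neg, zpow_natCast]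
    have ha : 0 < (1 - p ^ 2) ^ (n - (sz l + sz m)) := by positivity
    have hb : 0 < (1 - p ^ 2) ^ sz m := by positivity
    field_simp
  · have hR : 0 < (1 + p ^ 3 / (1 - p)) ^ (n - sz l) := by positivity
    have hk3 : (27 : ℝ) ≤ (k : ℝ) ^ 3 := by
      have : (3 : ℝ) ≤ k := by exact_mod_cast hk
      calc (27 : ℝ) = 3 ^ 3 := by norm_num
        _ ≤ (k : ℝ) ^ 3 := by gcongr
    have hz : (1 - p ^ 2) ^ (-2 : ℤ) = ((1 - p ^ 2)⁻¹) ^ 2 := by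
      rw [zpow_neg, inv_pow]
      norm_cast
    rw [hz]
    set R := (1 + p ^ 3 / (1 - p)) ^ (n - sz l)
    set Q := ((1 - p ^ 2)⁻¹) ^ 2
    have hQ : 0 < Q := by positivity
    have hM1 : 0 < (sz m : ℝ) - 1 := by linarith
    calc 2 * (R * Q) * (2 / sz m) = 4 * (R * Q) / sz m := by ring
      _ ≤ 3 * (k : ℝ) ^ 3 * (R * Q) / (sz m - 1) := by
        gcongr
        · linarith
        · linarith
      _ = _ := by ring
end

section
/- Fix k ≥ 3 and let n > 2k. Then for every p ∈ (0,1), the probability P_k^t(n,p) that a random Turán k-partite graph on n vertices with edge probability p has diameter at most 2 satisfies P_k^t(n,p) ≤ (2k/(n²(1−p²)^{n(1−1/k)+1})) · (1 + (k−1)(1−p²)^{1−n/k}(1−p))^{−1} · (1 − 2k/n)^{−1} + (4k³(1 + p³/(1−p))^{n(1−1/k)+1}(1−p²)^{−2}/(n(k−1))) · (1 − 2k/n)^{−4}. -/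
open scoped Classical

/-- The Turán partition of `n` vertices into `k` parts: the part sizes are as equal as
possible, each being `⌊n/k⌋` or `⌈n/k⌉`. -/
def turanSizes (k n : ℕ) : Fin k → ℕ :=
  fun i => if (i : ℕ) < n % k then n / k + 1 else n / k

/-- The probability that a random Turán `k`-partite graph on `n` vertices with edge
probability `p` is connected with diameter at most `2`. -/
noncomputable def turanKpartiteDiam2Prob (k n : ℕ) (p : ℝ) : ℝ :=
  kpartiteDiam2Prob k (turanSizes k n) p

/-- The expectation of `F` when the coordinates are independent Bernoulli variables with
success probabilities `c e`. -/
noncomputable def bernExp {E : Type*} [Fintype E] (c : E → ℝ) (F : (E → Bool) → ℝ) : ℝ :=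
  ∑ ω : E → Bool, (∏ e, if ω e then c e else 1 - c e) * F ω

/-- The real-valued indicator of the coordinate `e`. -/
def coord {E : Type*} (e : E) (ω : E → Bool) : ℝ := if ω e then 1 else 0

section Bernoulli

variable {E : Type*}

lemma coord_eq_zero_or_one (e : E) (ω : E → Bool) : coord e ω = 0 ∨ coord e ω = 1 := by
  unfold coord
  split_ifs <;> simp

lemma coord_le_one (e : E) (ω : E → Bool) : coord e ω ≤ 1 := by
  rcases coord_eq_zero_or_one e ω with h | h <;> simp [h]

lemma dependsOn_coord {s : Set E} {e : E} (he : e ∈ s) : DependsOn (coord e) s := by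
  intro ω ω' h
  simp only [coord, h e he]

lemma DependsOn.real_mul {F G : (E → Bool) → ℝ} {s : Set E} (hF : DependsOn F s)
    (hG : DependsOn G s) : DependsOn (fun ω => F ω * G ω) s :=
  fun _ _ h => congrArg₂ (· * ·) (hF h) (hG h)

lemma DependsOn.real_one_sub {F : (E → Bool) → ℝ} {s : Set E} (hF : DependsOn F s) :
    DependsOn (fun ω => 1 - F ω) s :=
  fun _ _ h => congrArg (1 - ·) (hF h)

lemma dependsOn_prod {ι : Type*} {t : Finset ι} {F : ι → (E → Bool) → ℝ} {s : Set E}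
    (hF : ∀ i ∈ t, DependsOn (F i) s) : DependsOn (fun ω => ∏ i ∈ t, F i ω) s :=
  fun _ _ h => Finset.prod_congr rfl fun i hi => hF i hi h

variable [Fintype E] {c : E → ℝ}

lemma sum_prod_bernoulli [DecidableEq E] (c : E → ℝ) :
    ∑ ω : E → Bool, ∏ e, (if ω e then c e else 1 - c e) = 1 := by
  have h := Finset.prod_univ_sum (fun _ : E => (Finset.univ : Finset Bool))
    (fun e b => if b then c e else 1 - c e)
  rw [Fintype.piFinset_univ] at h
  rw [← h]
  simp

lemma bernExp_const (r : ℝ) : bernExp c (fun _ => r) = r := by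
  rw [bernExp, ← Finset.sum_mul, sum_prod_bernoulli, one_mul]

lemma bernExp_add (F G : (E → Bool) → ℝ) :
    bernExp c (fun ω => F ω + G ω) = bernExp c F + bernExp c G := by
  simp only [bernExp, mul_add, Finset.sum_add_distrib]

lemma bernExp_sub (F G : (E → Bool) → ℝ) :
    bernExp c (fun ω => F ω - G ω) = bernExp c F - bernExp c G := by
  simp only [bernExp, mul_sub, Finset.sum_sub_distrib]

lemma bernExp_const_mul (r : ℝ) (F : (E → Bool) → ℝ) :
    bernExp c (fun ω => r * F ω) = r * bernExp c F := by
  simp only [bernExp, Finset.mul_sum]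
  exact Finset.sum_congr rfl fun _ _ => by ring

lemma bernExp_sum {ι : Type*} (s : Finset ι) (F : ι → (E → Bool) → ℝ) :
    bernExp c (fun ω => ∑ i ∈ s, F i ω) = ∑ i ∈ s, bernExp c (F i) := by
  simp only [bernExp, Finset.mul_sum]
  rw [Finset.sum_comm]

lemma bernoulliWeight_nonneg (hc : ∀ e, 0 ≤ c e ∧ c e ≤ 1) (ω : E → Bool) :
    0 ≤ ∏ e, (if ω e then c e else 1 - c e) := by
  refine Finset.prod_nonneg fun e _ => ?_
  split_ifs
  · exact (hc e).1
  · linarith [(hc e).2]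

lemma bernExp_mono (hc : ∀ e, 0 ≤ c e ∧ c e ≤ 1) {F G : (E → Bool) → ℝ}
    (h : ∀ ω, F ω ≤ G ω) : bernExp c F ≤ bernExp c G :=
  Finset.sum_le_sum fun ω _ =>
    mul_le_mul_of_nonneg_left (h ω) (bernoulliWeight_nonneg hc ω)

lemma bernExp_mul_of_dependsOn {F G : (E → Bool) → ℝ} {s t : Set E} (hF : DependsOn F s)
    (hG : DependsOn G t) (hst : Disjoint s t) :
    bernExp c (fun ω => F ω * G ω) = bernExp c F * bernExp c G := by
  let φ := Equiv.piEquivPiSubtypeProd (fun e => e ∈ s) (fun _ : E => Bool)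
  let w₁ : ({e // e ∈ s} → Bool) → ℝ := fun α => ∏ e, if α e then c e else 1 - c e
  let w₂ : ({e // e ∉ s} → Bool) → ℝ := fun β => ∏ e, if β e then c e else 1 - c e
  let F₁ : ({e // e ∈ s} → Bool) → ℝ := fun α => F (φ.symm (α, fun _ => false))
  let G₂ : ({e // e ∉ s} → Bool) → ℝ := fun β => G (φ.symm (fun _ => false, β))
  have split : ∀ H : (E → Bool) → ℝ,
      bernExp c H = ∑ α, ∑ β, w₁ α * w₂ β * H (φ.symm (α, β)) := by
    intro H
    rw [bernExp, ← Fintype.sum_prod_type' (f := fun α β => w₁ α * w₂ β * H (φ.symm (α, β)))]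
    refine Fintype.sum_equiv φ _ _ fun ω => ?_
    rw [Prod.mk.eta, Equiv.symm_apply_apply]
    congr 1
    exact (Fintype.prod_subtype_mul_prod_subtype (fun e => e ∈ s) _).symm
  have hF₁ : ∀ α β, F (φ.symm (α, β)) = F₁ α := fun α β => hF fun e he => by
    simp [φ, Equiv.piEquivPiSubtypeProd, he]
  have hG₂ : ∀ α β, G (φ.symm (α, β)) = G₂ β := fun α β => hG fun e he => by
    have : e ∉ s := fun h => Set.disjoint_left.1 hst h he
    simp [φ, Equiv.piEquivPiSubtypeProd, this]
  have h₁ : ∑ α, w₁ α = 1 := sum_prod_bernoulli _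
  have h₂ : ∑ β, w₂ β = 1 := sum_prod_bernoulli _
  rw [split fun ω => F ω * G ω, split F, split G]
  simp only [hF₁, hG₂]
  have e₁ : ∑ α, ∑ β, w₁ α * w₂ β * F₁ α = ∑ α, w₁ α * F₁ α := by
    calc _ = ∑ α, w₁ α * F₁ α * ∑ β, w₂ β := by
          refine Finset.sum_congr rfl fun α _ => ?_
          rw [Finset.mul_sum]
          exact Finset.sum_congr rfl fun β _ => by ring
      _ = _ := by simp [h₂]
  have e₂ : ∑ α, ∑ β, w₁ α * w₂ β * G₂ β = ∑ β, w₂ β * G₂ β := by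
    calc _ = ∑ α, w₁ α * ∑ β, w₂ β * G₂ β := by
          refine Finset.sum_congr rfl fun α _ => ?_
          rw [Finset.mul_sum]
          exact Finset.sum_congr rfl fun β _ => by ring
      _ = _ := by rw [← Finset.sum_mul, h₁, one_mul]
  rw [e₁, e₂, Finset.sum_mul_sum]
  exact Finset.sum_congr rfl fun α _ => Finset.sum_congr rfl fun β _ => by ring

lemma bernExp_prod_of_dependsOn {ι : Type*} (t : Finset ι) {F : ι → (E → Bool) → ℝ}
    {s : ι → Set E} (hF : ∀ i ∈ t, DependsOn (F i) (s i))
    (hs : ∀ i ∈ t, ∀ j ∈ t, i ≠ j → Disjoint (s i) (s j)) :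
    bernExp c (fun ω => ∏ i ∈ t, F i ω) = ∏ i ∈ t, bernExp c (F i) := by
  induction t using Finset.induction_on with
  | empty => simpa using bernExp_const 1
  | insert a t ha ih =>
    simp only [Finset.prod_insert ha]
    rw [← ih (fun i hi => hF i (Finset.mem_insert_of_mem hi)) fun i hi j hj =>
      hs i (Finset.mem_insert_of_mem hi) j (Finset.mem_insert_of_mem hj)]
    refine bernExp_mul_of_dependsOn (t := ⋃ i ∈ t, s i) (hF a (Finset.mem_insert_self a t))
      (dependsOn_prod fun i hi => ?_) ?_
    · exact (hF i (Finset.mem_insert_of_mem hi)).mono (Set.subset_biUnion_of_mem hi)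
    · refine Set.disjoint_iUnion₂_right.2 fun i hi => ?_
      exact hs a (Finset.mem_insert_self a t) i (Finset.mem_insert_of_mem hi)
        fun h => ha (h ▸ hi)

lemma bernExp_coord (e : E) : bernExp c (coord e) = c e := by
  have h := Finset.prod_univ_sum (fun _ : E => (Finset.univ : Finset Bool))
    (fun e' b => (if b then c e' else 1 - c e') * if e' = e then (if b then 1 else 0) else 1)
  rw [Fintype.piFinset_univ] at h
  have h2 : bernExp c (coord e) = ∑ ω : E → Bool, ∏ e', ((if ω e' then c e' else 1 - c e') *
      if e' = e then (if ω e' then 1 else 0) else 1) := by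
    refine Finset.sum_congr rfl fun ω _ => ?_
    rw [Finset.prod_mul_distrib, Finset.prod_ite_eq']
    simp [coord]
  rw [h2, ← h, Finset.prod_eq_single e]
  · simp
  · intro b _ hb
    simp [hb]
  · simp

lemma bernExp_prod_coord (t : Finset E) :
    bernExp c (fun ω => ∏ e ∈ t, coord e ω) = ∏ e ∈ t, c e := by
  rw [bernExp_prod_of_dependsOn t (s := fun e => {e}) (fun e _ => dependsOn_coord rfl)
    fun i _ j _ hij => by simpa using hij]
  exact Finset.prod_congr rfl fun e _ => bernExp_coord e

lemma bernExp_coord_mul {e₁ e₂ : E} (h : e₁ ≠ e₂) :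
    bernExp c (fun ω => coord e₁ ω * coord e₂ ω) = c e₁ * c e₂ := by
  simpa [Finset.prod_pair h] using bernExp_prod_coord (c := c) {e₁, e₂}

lemma bernExp_coord_mul₃ {e₁ e₂ e₃ : E} (h₁₂ : e₁ ≠ e₂) (h₁₃ : e₁ ≠ e₃) (h₂₃ : e₂ ≠ e₃) :
    bernExp c (fun ω => coord e₁ ω * coord e₂ ω * coord e₃ ω) = c e₁ * c e₂ * c e₃ := by
  have h := bernExp_prod_coord (c := c) {e₁, e₂, e₃}
  simpa [Finset.prod_insert, h₁₂, h₁₃, h₂₃, mul_assoc] using h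

lemma bernExp_coord_mul₄ {e₁ e₂ e₃ e₄ : E} (h₁₂ : e₁ ≠ e₂) (h₁₃ : e₁ ≠ e₃) (h₁₄ : e₁ ≠ e₄)
    (h₂₃ : e₂ ≠ e₃) (h₂₄ : e₂ ≠ e₄) (h₃₄ : e₃ ≠ e₄) :
    bernExp c (fun ω => coord e₁ ω * coord e₂ ω * coord e₃ ω * coord e₄ ω) =
      c e₁ * c e₂ * c e₃ * c e₄ := by
  have h := bernExp_prod_coord (c := c) {e₁, e₂, e₃, e₄}
  simpa [Finset.prod_insert, h₁₂, h₁₃, h₁₄, h₂₃, h₂₄, h₃₄, mul_assoc] using h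

lemma bernExp_one_sub_coord (e : E) : bernExp c (fun ω => 1 - coord e ω) = 1 - c e := by
  rw [bernExp_sub, bernExp_const, bernExp_coord]

/-- No two of the edges of a path of length two are present. -/
lemma bernExp_one_sub_coord_mul {e₁ e₂ : E} (h : e₁ ≠ e₂) :
    bernExp c (fun ω => 1 - coord e₁ ω * coord e₂ ω) = 1 - c e₁ * c e₂ := by
  rw [bernExp_sub, bernExp_const, bernExp_coord_mul h]

/-- Probability that neither of two pairs of edges sharing the edge `e₁` is fully present. -/
lemma bernExp_cherry {e₁ e₂ e₃ : E} (h₁₂ : e₁ ≠ e₂) (h₁₃ : e₁ ≠ e₃) (h₂₃ : e₂ ≠ e₃) :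
    bernExp c (fun ω => (1 - coord e₁ ω * coord e₂ ω) * (1 - coord e₁ ω * coord e₃ ω)) =
      1 - c e₁ * c e₂ - c e₁ * c e₃ + c e₁ * c e₂ * c e₃ := by
  have h : (fun ω : E → Bool =>
      (1 - coord e₁ ω * coord e₂ ω) * (1 - coord e₁ ω * coord e₃ ω)) =
      fun ω => 1 - coord e₁ ω * coord e₂ ω - coord e₁ ω * coord e₃ ω +
        coord e₁ ω * coord e₂ ω * coord e₃ ω := by
    funext ω
    rcases coord_eq_zero_or_one e₁ ω with h | h <;> rw [h] <;> ring
  rw [h, bernExp_add, bernExp_sub, bernExp_sub, bernExp_const, bernExp_coord_mul h₁₂,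
    bernExp_coord_mul h₁₃, bernExp_coord_mul₃ h₁₂ h₁₃ h₂₃]

/-- Probability that no two cyclically consecutive edges of a four-cycle are present. -/
lemma bernExp_fourCycle {e₁ e₂ e₃ e₄ : E} (h₁₂ : e₁ ≠ e₂) (h₁₃ : e₁ ≠ e₃) (h₁₄ : e₁ ≠ e₄)
    (h₂₃ : e₂ ≠ e₃) (h₂₄ : e₂ ≠ e₄) (h₃₄ : e₃ ≠ e₄) :
    bernExp c (fun ω => (1 - coord e₁ ω * coord e₂ ω) * (1 - coord e₃ ω * coord e₄ ω) *
        ((1 - coord e₁ ω * coord e₃ ω) * (1 - coord e₂ ω * coord e₄ ω))) =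
      1 - c e₁ * c e₂ - c e₃ * c e₄ - c e₁ * c e₃ - c e₂ * c e₄ +
        c e₁ * c e₂ * c e₃ + c e₁ * c e₂ * c e₄ + c e₁ * c e₃ * c e₄ + c e₂ * c e₃ * c e₄ -
        c e₁ * c e₂ * c e₃ * c e₄ := by
  have h : (fun ω : E → Bool =>
      (1 - coord e₁ ω * coord e₂ ω) * (1 - coord e₃ ω * coord e₄ ω) *
        ((1 - coord e₁ ω * coord e₃ ω) * (1 - coord e₂ ω * coord e₄ ω))) =
      fun ω => 1 - coord e₁ ω * coord e₂ ω - coord e₃ ω * coord e₄ ω -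
        coord e₁ ω * coord e₃ ω - coord e₂ ω * coord e₄ ω +
        coord e₁ ω * coord e₂ ω * coord e₃ ω + coord e₁ ω * coord e₂ ω * coord e₄ ω +
        coord e₁ ω * coord e₃ ω * coord e₄ ω + coord e₂ ω * coord e₃ ω * coord e₄ ω -
        coord e₁ ω * coord e₂ ω * coord e₃ ω * coord e₄ ω := by
    funext ω
    rcases coord_eq_zero_or_one e₁ ω with h | h <;>
      rcases coord_eq_zero_or_one e₄ ω with h' | h' <;> rw [h, h'] <;>
      rcases coord_eq_zero_or_one e₂ ω with h₂ | h₂ <;>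
      rcases coord_eq_zero_or_one e₃ ω with h₃ | h₃ <;> rw [h₂, h₃] <;> ring
  rw [h]
  simp only [bernExp_add, bernExp_sub, bernExp_const]
  rw [bernExp_coord_mul h₁₂, bernExp_coord_mul h₃₄, bernExp_coord_mul h₁₃,
    bernExp_coord_mul h₂₄, bernExp_coord_mul₃ h₁₂ h₁₃ h₂₃, bernExp_coord_mul₃ h₁₂ h₁₄ h₂₄,
    bernExp_coord_mul₃ h₁₃ h₁₄ h₃₄, bernExp_coord_mul₃ h₂₃ h₂₄ h₃₄,
    bernExp_coord_mul₄ h₁₂ h₁₃ h₁₄ h₂₃ h₂₄ h₃₄]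

/-- Second moment method: if `g ≤ 1` vanishes wherever `Y` does not, then
`𝔼[g] 𝔼[Y]² ≤ Var Y`. -/
lemma bernExp_mul_sq_le_variance (hc : ∀ e, 0 ≤ c e ∧ c e ≤ 1) {g Y : (E → Bool) → ℝ}
    (hg : ∀ ω, g ω ≤ 1) (hgY : ∀ ω, Y ω ≠ 0 → g ω ≤ 0) :
    bernExp c g * bernExp c Y ^ 2 ≤ bernExp c (fun ω => Y ω * Y ω) - bernExp c Y ^ 2 := by
  set m := bernExp c Y with hm
  have h : bernExp c (fun ω => m ^ 2 * g ω) ≤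
      bernExp c (fun ω => Y ω * Y ω - 2 * m * Y ω + m ^ 2) := by
    refine bernExp_mono hc fun ω => ?_
    by_cases hY : Y ω = 0
    · rw [hY]
      nlinarith [hg ω, sq_nonneg m]
    · nlinarith [hgY ω hY, sq_nonneg m, sq_nonneg (Y ω - m)]
  rw [bernExp_const_mul, bernExp_add, bernExp_sub, bernExp_const_mul, bernExp_const,
    ← hm] at h
  linarith

end Bernoulli

/-- Correlation bound for one common neighbour constraint of two pairs sharing a vertex. -/
lemma cherry_le {p : ℝ} (hp0 : 0 < p) (hp1 : p < 1) {x y z : ℝ} (hx : x = 0 ∨ x = p)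
    (hy : y = 0 ∨ y = p) (hz : z = 0 ∨ z = p) :
    1 - x * y - x * z + x * y * z ≤
      (if x = 0 then 1 else 1 + p ^ 3 / (1 - p)) * ((1 - x * y) * (1 - x * z)) := by
  have hq : 0 < 1 - p := by linarith
  have hr : 0 < p ^ 3 / (1 - p) := by positivity
  have ha : 0 < 1 - p * p := by nlinarith
  rcases hx with hx | hx
  · simp [hx]
  rw [if_neg (hx ▸ hp0.ne')]
  rcases hy with hy | hy <;> rcases hz with hz | hz <;> rw [hx, hy, hz]
  · linarith
  · nlinarith [mul_pos hr ha]
  · nlinarith [mul_pos hr ha]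
  · have e : 1 + p ^ 3 / (1 - p) = (1 - p + p ^ 3) / (1 - p) := by field_simp
    rw [e, div_mul_eq_mul_div, le_div_iff₀ hq]
    have h : 0 ≤ (1 - p) ^ 2 * (2 * p ^ 4 + p ^ 5) := by positivity
    linarith

/-- Correlation bound for the four-cycle spanned by two disjoint pairs of vertices. -/
lemma fourCycle_le {p : ℝ} (hp0 : 0 < p) (hp1 : p < 1) {x y z w : ℝ} (hx : x = 0 ∨ x = p)
    (hy : y = 0 ∨ y = p) (hz : z = 0 ∨ z = p) (hw : w = 0 ∨ w = p) :
    (1 - p ^ 2) ^ 2 * (1 - x * y - z * w - x * z - y * w + x * y * z + x * y * w + x * z * w +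
        y * z * w - x * y * z * w) ≤
      ((1 - p ^ 2) ^ 2 + 5 * p ^ 3) *
        ((1 - x * y) * (1 - z * w) * ((1 - x * z) * (1 - y * w))) := by
  have ha : 0 < 1 - p ^ 2 := by nlinarith
  have h₁ : 0 < p ^ 3 := by positivity
  have h₂ : 0 < p ^ 3 * (1 - p ^ 2) := by positivity
  have h₃ : 0 < (1 - p ^ 2) ^ 2 * (p ^ 3 * (4 + p)) := by positivity
  have h₄ : 0 ≤ (1 - p ^ 2) ^ 2 * ((1 - p) ^ 2 * p ^ 3 * (1 + 9 * p + 7 * p ^ 2 + p ^ 3)) := by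
    positivity
  rcases hx with hx | hx <;> rcases hy with hy | hy <;> rcases hz with hz | hz <;>
    rcases hw with hw | hw <;> rw [hx, hy, hz, hw] <;> linarith

section FarPairs

variable {V ι : Type*}

/-- The probability of a pair of vertices being joined: `p` if the two vertices have
different `f`-values and `0` otherwise. -/
noncomputable def edgeProb (f : V → ι) (p : ℝ) : Sym2 V → ℝ :=
  Sym2.lift ⟨fun u v => if f u = f v then 0 else p, fun u v => by simp only [eq_comm]⟩

lemma edgeProb_mk (f : V → ι) (p : ℝ) (u v : V) :
    edgeProb f p s(u, v) = if f u = f v then 0 else p := rfl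

lemma edgeProb_mem (f : V → ι) {p : ℝ} (hp0 : 0 ≤ p) (hp1 : p ≤ 1) (e : Sym2 V) :
    0 ≤ edgeProb f p e ∧ edgeProb f p e ≤ 1 := by
  induction e using Sym2.ind with
  | _ u v =>
    rw [edgeProb_mk]
    split_ifs <;> simp [hp0, hp1]

lemma one_sub_coord_nonneg {E : Type*} (e : E) (ω : E → Bool) : 0 ≤ 1 - coord e ω := by
  linarith [coord_le_one e ω]

lemma one_sub_coord_mul_mem {E : Type*} (e e' : E) (ω : E → Bool) :
    0 ≤ 1 - coord e ω * coord e' ω ∧ 1 - coord e ω * coord e' ω ≤ 1 := by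
  rcases coord_eq_zero_or_one e ω with h | h <;>
    rcases coord_eq_zero_or_one e' ω with h' | h' <;> simp [h, h']

lemma prod_one_sub_coord_mul_nonneg (u v : V) (t : Finset V) (ω : Sym2 V → Bool) :
    0 ≤ ∏ z ∈ t, (1 - coord s(u, z) ω * coord s(v, z) ω) :=
  Finset.prod_nonneg fun _ _ => (one_sub_coord_mul_mem _ _ ω).1

lemma dependsOn_coord_star {K : Finset V} {y z : V} (hy : y ∈ K) :
    DependsOn (coord s(y, z)) {e | ∃ y ∈ K, e = s(y, z)} :=
  dependsOn_coord ⟨y, hy, rfl⟩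

lemma dependsOn_coord_inside {K : Finset V} {y z : V} (hy : y ∈ K) (hz : z ∈ K) :
    DependsOn (coord s(y, z)) {e | ∀ y ∈ e, y ∈ K} :=
  dependsOn_coord (by simp [hy, hz])

lemma one_sub_edgeProb (f : V → ι) (p : ℝ) (u v : V) :
    1 - edgeProb f p s(u, v) = if f u = f v then 1 else 1 - p := by
  rw [edgeProb_mk]
  split_ifs <;> ring

lemma edgeProb_eq_zero_or (f : V → ι) (p : ℝ) (e : Sym2 V) :
    edgeProb f p e = 0 ∨ edgeProb f p e = p := by
  induction e using Sym2.ind with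
  | _ u v =>
    rw [edgeProb_mk]
    split_ifs <;> simp

lemma one_sub_edgeProb_mul_bounds (f : V → ι) (p : ℝ) (e e' : Sym2 V) :
    1 - p ^ 2 ≤ 1 - edgeProb f p e * edgeProb f p e' ∧
      1 - edgeProb f p e * edgeProb f p e' ≤ 1 := by
  rcases edgeProb_eq_zero_or f p e with h | h <;>
    rcases edgeProb_eq_zero_or f p e' with h' | h' <;> rw [h, h'] <;>
    constructor <;> nlinarith

variable [Fintype V]

/-- The indicator that the distinct vertices `u`, `v` are neither adjacent nor have a
common neighbour in the graph with edge indicator `ω`. -/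
noncomputable def farPair (u v : V) (ω : Sym2 V → Bool) : ℝ :=
  (1 - coord s(u, v) ω) * ∏ z ∈ ({u, v} : Finset V)ᶜ, (1 - coord s(u, z) ω * coord s(v, z) ω)

/-- The probability that two distinct vertices in parts `i` and `j` are neither adjacent nor
have a common neighbour. -/
noncomputable def farProb (f : V → ι) (p : ℝ) (i j : ι) : ℝ :=
  (if i = j then 1 else 1 - p) *
    (1 - p ^ 2) ^ (Finset.univ.filter fun z => f z ≠ i ∧ f z ≠ j).card

lemma farPair_comm (u v : V) : farPair u v = farPair v u := by
  funext ω
  simp only [farPair, Sym2.eq_swap (a := v) (b := u), Finset.pair_comm v u, mul_comm]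

lemma farPair_eq_zero_or_one (u v : V) (ω : Sym2 V → Bool) :
    farPair u v ω = 0 ∨ farPair u v ω = 1 := by
  unfold farPair
  rcases coord_eq_zero_or_one s(u, v) ω with h | h
  · by_cases hz : ∃ z ∈ ({u, v} : Finset V)ᶜ, 1 - coord s(u, z) ω * coord s(v, z) ω = 0
    · exact Or.inl (by rw [Finset.prod_eq_zero_iff.2 hz, mul_zero])
    · right
      rw [h, sub_zero, one_mul]
      refine Finset.prod_eq_one fun z hz' => ?_
      have : 1 - coord s(u, z) ω * coord s(v, z) ω ≠ 0 := fun h => hz ⟨z, hz', h⟩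
      rcases coord_eq_zero_or_one s(u, z) ω with h | h <;>
        rcases coord_eq_zero_or_one s(v, z) ω with h' | h' <;> simp_all
  · simp [h]

/-- Removing constraints from a far pair. -/
lemma farPair_le {u v : V} {K : Finset V} (hu : u ∈ K) (hv : v ∈ K) (ω : Sym2 V → Bool) :
    farPair u v ω ≤ (1 - coord s(u, v) ω) *
      ∏ z ∈ Kᶜ, (1 - coord s(u, z) ω * coord s(v, z) ω) := by
  refine mul_le_mul_of_nonneg_left ?_ (one_sub_coord_nonneg _ _)
  refine Finset.prod_le_prod_of_subset_of_le_one ?_ ?_ ?_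
  · exact Finset.compl_subset_compl.2 (by simp [Finset.insert_subset_iff, hu, hv])
  · exact fun _ _ => (one_sub_coord_mul_mem _ _ ω).1
  · exact fun _ _ _ => (one_sub_coord_mul_mem _ _ ω).2

/-- Factorisation of expectations over the edges inside `K` and the stars from the vertices
outside `K` to `K`. -/
lemma bernExp_mul_prod_compl {c : Sym2 V → ℝ} (K : Finset V) {F₀ : (Sym2 V → Bool) → ℝ}
    {F : V → (Sym2 V → Bool) → ℝ} (h₀ : DependsOn F₀ {e | ∀ y ∈ e, y ∈ K})
    (hF : ∀ z ∈ Kᶜ, DependsOn (F z) {e | ∃ y ∈ K, e = s(y, z)}) :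
    bernExp c (fun ω => F₀ ω * ∏ z ∈ Kᶜ, F z ω) = bernExp c F₀ * ∏ z ∈ Kᶜ, bernExp c (F z) := by
  rw [← bernExp_prod_of_dependsOn Kᶜ hF]
  · refine bernExp_mul_of_dependsOn (t := ⋃ z ∈ Kᶜ, {e | ∃ y ∈ K, e = s(y, z)}) h₀
      (dependsOn_prod fun z hz => ?_) ?_
    · exact (hF z hz).mono (Set.subset_biUnion_of_mem (u := fun z => {e | ∃ y ∈ K, e = s(y, z)}) hz)
    · refine Set.disjoint_iUnion₂_right.2 fun z hz => Set.disjoint_left.2 ?_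
      rintro e he ⟨y, -, rfl⟩
      exact Finset.mem_compl.1 hz (he z (Sym2.mem_mk_right y z))
  · intro z hz z' hz' hne
    refine Set.disjoint_left.2 ?_
    rintro e ⟨y, hy, rfl⟩ ⟨y', hy', he⟩
    rw [Finset.mem_compl] at hz hz'
    rcases Sym2.eq_iff.1 he with ⟨-, h⟩ | ⟨h, h'⟩
    · exact hne h
    · exact hz' (h ▸ hy)

lemma prod_one_sub_edgeProb_mul (f : V → ι) (p : ℝ) (u v : V) {K : Finset V}
    (hK : {u, v} ⊆ K) :
    (∏ z ∈ Kᶜ, (1 - edgeProb f p s(u, z) * edgeProb f p s(v, z))) *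
      ∏ z ∈ K \ {u, v}, (1 - edgeProb f p s(u, z) * edgeProb f p s(v, z)) =
    (1 - p ^ 2) ^ (Finset.univ.filter fun z => f z ≠ f u ∧ f z ≠ f v).card := by
  rw [← Finset.prod_const, Finset.prod_filter, ← Finset.prod_union]
  · rw [← Finset.prod_subset (Finset.subset_univ (Kᶜ ∪ K \ {u, v}))]
    · refine Finset.prod_congr rfl fun z _ => ?_
      rw [edgeProb_mk, edgeProb_mk, eq_comm (a := f u), eq_comm (a := f v)]
      by_cases h : f z = f u <;> by_cases h' : f z = f v <;> simp [h, h', pow_two]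
    · intro z _ hz
      have : z = u ∨ z = v := by
        simp only [Finset.mem_union, Finset.mem_compl, Finset.mem_sdiff, not_or, not_not,
          not_and, Finset.mem_insert, Finset.mem_singleton] at hz
        tauto
      rcases this with rfl | rfl <;> simp
  · exact Finset.disjoint_left.2 fun z hz hz' =>
      Finset.mem_compl.1 hz (Finset.mem_sdiff.1 hz').1

lemma bernExp_farPair (f : V → ι) (p : ℝ) {u v : V} (huv : u ≠ v) :
    bernExp (edgeProb f p) (farPair u v) = farProb f p (f u) (f v) := by
  unfold farPair
  rw [bernExp_mul_prod_compl (F₀ := fun ω => 1 - coord s(u, v) ω)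
    (F := fun z ω => 1 - coord s(u, z) ω * coord s(v, z) ω),
    bernExp_one_sub_coord, one_sub_edgeProb, farProb,
    ← prod_one_sub_edgeProb_mul f p u v (Finset.Subset.refl _), Finset.sdiff_self,
    Finset.prod_empty, mul_one]
  · congr 1
    refine Finset.prod_congr rfl fun z hz => bernExp_one_sub_coord_mul ?_
    simp only [ne_eq, Sym2.congr_left]
    exact huv
  · exact (dependsOn_coord_inside (by simp) (by simp)).real_one_sub
  · exact fun z _ => ((dependsOn_coord_star (by simp)).real_mul
      (dependsOn_coord_star (by simp))).real_one_sub

lemma farProb_nonneg (f : V → ι) {p : ℝ} (hp0 : 0 ≤ p) (hp1 : p ≤ 1) (i j : ι) :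
    0 ≤ farProb f p i j := by
  refine mul_nonneg ?_ (pow_nonneg (by nlinarith) _)
  split_ifs <;> linarith

/-- Two pairs sharing the vertex `u`. -/
lemma bernExp_farPair_mul_of_share (f : V → ι) {p : ℝ} (hp0 : 0 < p) (hp1 : p < 1) {u v w : V}
    (huv : u ≠ v) (huw : u ≠ w) (hvw : v ≠ w) :
    (1 - p ^ 2) ^ 2 * bernExp (edgeProb f p) (fun ω => farPair u v ω * farPair u w ω) ≤
      (1 + p ^ 3 / (1 - p)) ^ (Finset.univ.filter fun z => f z ≠ f u).card *
        (farProb f p (f u) (f v) * farProb f p (f u) (f w)) := by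
  set ρ := 1 + p ^ 3 / (1 - p) with hρ
  set c := edgeProb f p with hc
  have hq : 0 < 1 - p := by linarith
  have ha : 0 < 1 - p ^ 2 := by nlinarith
  have hρ1 : 1 ≤ ρ := by
    have : 0 < p ^ 3 / (1 - p) := by positivity
    linarith
  set K : Finset V := {u, v, w} with hK
  have huK : u ∈ K := by simp [hK]
  have hvK : v ∈ K := by simp [hK]
  have hwK : w ∈ K := by simp [hK]
  let Q : V → ℝ := fun z => (1 - c s(u, z) * c s(v, z)) * (1 - c s(u, z) * c s(w, z))
  have hQ : ∀ z, 0 ≤ Q z := fun z => mul_nonneg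
    (ha.le.trans (one_sub_edgeProb_mul_bounds f p _ _).1)
    (ha.le.trans (one_sub_edgeProb_mul_bounds f p _ _).1)
  have hle : bernExp c (fun ω => farPair u v ω * farPair u w ω) ≤
      bernExp c (fun ω => (1 - coord s(u, v) ω) * (1 - coord s(u, w) ω) *
        ∏ z ∈ Kᶜ, (1 - coord s(u, z) ω * coord s(v, z) ω) *
          (1 - coord s(u, z) ω * coord s(w, z) ω)) := by
    refine bernExp_mono (edgeProb_mem f hp0.le hp1.le) fun ω => ?_
    rw [Finset.prod_mul_distrib, mul_mul_mul_comm]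
    refine mul_le_mul (farPair_le huK hvK ω) (farPair_le huK hwK ω) ?_ ?_
    · rcases farPair_eq_zero_or_one u w ω with h | h <;> simp [h]
    · exact mul_nonneg (one_sub_coord_nonneg _ _) (prod_one_sub_coord_mul_nonneg _ _ _ _)
  have heq : bernExp c (fun ω => (1 - coord s(u, v) ω) * (1 - coord s(u, w) ω) *
        ∏ z ∈ Kᶜ, (1 - coord s(u, z) ω * coord s(v, z) ω) *
          (1 - coord s(u, z) ω * coord s(w, z) ω)) ≤
      (1 - c s(u, v)) * (1 - c s(u, w)) *
        (ρ ^ (Finset.univ.filter fun z => f z ≠ f u).card * ∏ z ∈ Kᶜ, Q z) := by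
    rw [bernExp_mul_prod_compl K (F₀ := fun ω => (1 - coord s(u, v) ω) * (1 - coord s(u, w) ω))
      (F := fun z ω => (1 - coord s(u, z) ω * coord s(v, z) ω) *
        (1 - coord s(u, z) ω * coord s(w, z) ω))]
    · rw [bernExp_mul_of_dependsOn (s := {s(u, v)}) (t := {s(u, w)})
        (dependsOn_coord (Set.mem_singleton _)).real_one_sub
        (dependsOn_coord (Set.mem_singleton _)).real_one_sub
        (by simp only [Set.disjoint_singleton, ne_eq, Sym2.congr_right]; exact hvw),
        bernExp_one_sub_coord, bernExp_one_sub_coord]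
      refine mul_le_mul_of_nonneg_left ?_ (mul_nonneg
        (sub_nonneg.2 (edgeProb_mem f hp0.le hp1.le _).2)
        (sub_nonneg.2 (edgeProb_mem f hp0.le hp1.le _).2))
      calc _ ≤ ∏ z ∈ Kᶜ, (if f z ≠ f u then ρ else 1) * Q z := by
            refine Finset.prod_le_prod (fun z _ => ?_) fun z hz => ?_
            · refine le_trans (le_of_eq ?_) (bernExp_mono (edgeProb_mem f hp0.le hp1.le)
                (F := fun _ => 0) fun ω => ?_)
              · rw [bernExp_const]
              · exact mul_nonneg (one_sub_coord_mul_mem _ _ _).1 (one_sub_coord_mul_mem _ _ _).1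
            · have hne : ∀ {a b : V}, a ≠ b → s(a, z) ≠ s(b, z) := fun h => by
                simpa only [ne_eq, Sym2.congr_left] using h
              rw [bernExp_cherry (hne huv) (hne huw) (hne hvw)]
              refine (cherry_le hp0 hp1 (edgeProb_eq_zero_or f p _) (edgeProb_eq_zero_or f p _)
                (edgeProb_eq_zero_or f p _)).trans (le_of_eq ?_)
              congr 1
              rw [edgeProb_mk]
              by_cases h : f u = f z
              · simp [h]
              · simp [h, Ne.symm h, hp0.ne', hρ]
        _ = (∏ z ∈ Kᶜ, if f z ≠ f u then ρ else 1) * ∏ z ∈ Kᶜ, Q z := Finset.prod_mul_distrib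
        _ ≤ _ := by
            refine mul_le_mul_of_nonneg_right ?_ (Finset.prod_nonneg fun z _ => hQ z)
            rw [← Finset.prod_filter, Finset.prod_const]
            exact pow_le_pow_right₀ hρ1
              (Finset.card_le_card (Finset.filter_subset_filter _ (Finset.subset_univ _)))
    · exact (dependsOn_coord_inside huK hvK).real_one_sub.real_mul
        (dependsOn_coord_inside huK hwK).real_one_sub
    · exact fun z _ => ((dependsOn_coord_star huK).real_mul
        (dependsOn_coord_star hvK)).real_one_sub.real_mul
        ((dependsOn_coord_star huK).real_mul (dependsOn_coord_star hwK)).real_one_sub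
  have hv : K \ {u, v} = {w} := by
    ext z
    simp only [hK, Finset.mem_sdiff, Finset.mem_insert, Finset.mem_singleton]
    grind
  have hw : K \ {u, w} = {v} := by
    ext z
    simp only [hK, Finset.mem_sdiff, Finset.mem_insert, Finset.mem_singleton]
    grind
  have pv := prod_one_sub_edgeProb_mul f p u v (K := K) (by simp [hK, Finset.insert_subset_iff])
  have pw := prod_one_sub_edgeProb_mul f p u w (K := K) (by simp [hK, Finset.insert_subset_iff])
  rw [hv, Finset.prod_singleton] at pv
  rw [hw, Finset.prod_singleton] at pw
  have hfar : (1 - c s(u, v)) * (1 - c s(u, w)) * ((∏ z ∈ Kᶜ, Q z) *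
      ((1 - c s(u, w) * c s(v, w)) * (1 - c s(u, v) * c s(w, v)))) =
      farProb f p (f u) (f v) * farProb f p (f u) (f w) := by
    rw [farProb, farProb, ← pv, ← pw, ← one_sub_edgeProb, ← one_sub_edgeProb,
      Finset.prod_mul_distrib]
    ring
  have hcorner : (1 - p ^ 2) ^ 2 ≤
      (1 - c s(u, w) * c s(v, w)) * (1 - c s(u, v) * c s(w, v)) := by
    rw [pow_two]
    exact mul_le_mul (one_sub_edgeProb_mul_bounds f p _ _).1
      (one_sub_edgeProb_mul_bounds f p _ _).1 ha.le
      (ha.le.trans (one_sub_edgeProb_mul_bounds f p _ _).1)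
  have hA : 0 ≤ (1 - c s(u, v)) * (1 - c s(u, w)) *
      (ρ ^ (Finset.univ.filter fun z => f z ≠ f u).card * ∏ z ∈ Kᶜ, Q z) :=
    mul_nonneg (mul_nonneg (sub_nonneg.2 (edgeProb_mem f hp0.le hp1.le _).2)
      (sub_nonneg.2 (edgeProb_mem f hp0.le hp1.le _).2))
      (mul_nonneg (pow_nonneg (by linarith) _) (Finset.prod_nonneg fun z _ => hQ z))
  calc _ ≤ (1 - p ^ 2) ^ 2 * ((1 - c s(u, v)) * (1 - c s(u, w)) *
        (ρ ^ (Finset.univ.filter fun z => f z ≠ f u).card * ∏ z ∈ Kᶜ, Q z)) :=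
        mul_le_mul_of_nonneg_left (hle.trans heq) (sq_nonneg _)
    _ ≤ (1 - c s(u, w) * c s(v, w)) * (1 - c s(u, v) * c s(w, v)) *
        ((1 - c s(u, v)) * (1 - c s(u, w)) *
        (ρ ^ (Finset.univ.filter fun z => f z ≠ f u).card * ∏ z ∈ Kᶜ, Q z)) :=
        mul_le_mul_of_nonneg_right hcorner hA
    _ = _ := by
        rw [← hfar]
        ring

/-- Two disjoint pairs. -/
lemma bernExp_farPair_mul_of_disjoint (f : V → ι) {p : ℝ} (hp0 : 0 < p) (hp1 : p < 1)
    {u v w x : V} (huv : u ≠ v) (huw : u ≠ w) (hux : u ≠ x) (hvw : v ≠ w) (hvx : v ≠ x)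
    (hwx : w ≠ x) :
    (1 - p ^ 2) ^ 2 * bernExp (edgeProb f p) (fun ω => farPair u v ω * farPair w x ω) ≤
      ((1 - p ^ 2) ^ 2 + 5 * p ^ 3) *
        (farProb f p (f u) (f v) * farProb f p (f w) (f x)) := by
  set c := edgeProb f p with hc
  have ha : 0 < 1 - p ^ 2 := by nlinarith
  set K : Finset V := {u, v, w, x} with hK
  have huK : u ∈ K := by simp [hK]
  have hvK : v ∈ K := by simp [hK]
  have hwK : w ∈ K := by simp [hK]
  have hxK : x ∈ K := by simp [hK]
  let Q : V → ℝ := fun z => (1 - c s(u, z) * c s(v, z)) * (1 - c s(w, z) * c s(x, z))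
  have hQ : ∀ z, 0 ≤ Q z := fun z => mul_nonneg
    (ha.le.trans (one_sub_edgeProb_mul_bounds f p _ _).1)
    (ha.le.trans (one_sub_edgeProb_mul_bounds f p _ _).1)
  let C : (Sym2 V → Bool) → ℝ := fun ω =>
    (1 - coord s(u, w) ω * coord s(v, w) ω) * (1 - coord s(u, x) ω * coord s(v, x) ω) *
      ((1 - coord s(u, w) ω * coord s(u, x) ω) * (1 - coord s(v, w) ω * coord s(v, x) ω))
  have hv : K \ {u, v} = {w, x} := by
    ext z
    simp only [hK, Finset.mem_sdiff, Finset.mem_insert, Finset.mem_singleton]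
    grind
  have hw : K \ {w, x} = {u, v} := by
    ext z
    simp only [hK, Finset.mem_sdiff, Finset.mem_insert, Finset.mem_singleton]
    grind
  have hsplit : ∀ {a b : V} (F : V → ℝ), {a, b} ⊆ K →
      ∏ z ∈ ({a, b} : Finset V)ᶜ, F z = (∏ z ∈ Kᶜ, F z) * ∏ z ∈ K \ {a, b}, F z := by
    intro a b F hab
    rw [← Finset.prod_union (Finset.disjoint_left.2 fun z hz hz' =>
      Finset.mem_compl.1 hz (Finset.mem_sdiff.1 hz').1)]
    congr 1
    ext z
    have := @hab z
    simp only [Finset.mem_union, Finset.mem_compl, Finset.mem_sdiff]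
    tauto
  have heq : (fun ω => farPair u v ω * farPair w x ω) =
      fun ω => (1 - coord s(u, v) ω) * ((1 - coord s(w, x) ω) * C ω) *
        ∏ z ∈ Kᶜ, (1 - coord s(u, z) ω * coord s(v, z) ω) *
          (1 - coord s(w, z) ω * coord s(x, z) ω) := by
    funext ω
    rw [farPair, farPair, hsplit _ (by simp [hK, Finset.insert_subset_iff]),
      hsplit _ (by simp [hK, Finset.insert_subset_iff]), hv, hw, Finset.prod_pair hwx,
      Finset.prod_pair huv, Finset.prod_mul_distrib, Sym2.eq_swap (a := w) (b := u),
      Sym2.eq_swap (a := x) (b := u), Sym2.eq_swap (a := w) (b := v),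
      Sym2.eq_swap (a := x) (b := v)]
    ring
  have hCdep : DependsOn C {s(u, w), s(v, w), s(u, x), s(v, x)} := by
    refine (((dependsOn_coord ?_).real_mul (dependsOn_coord ?_)).real_one_sub.real_mul
      ((dependsOn_coord ?_).real_mul (dependsOn_coord ?_)).real_one_sub).real_mul
      (((dependsOn_coord ?_).real_mul (dependsOn_coord ?_)).real_one_sub.real_mul
      ((dependsOn_coord ?_).real_mul (dependsOn_coord ?_)).real_one_sub) <;> simp
  have hEC : (1 - p ^ 2) ^ 2 * bernExp c C ≤ ((1 - p ^ 2) ^ 2 + 5 * p ^ 3) *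
      ((1 - c s(u, w) * c s(v, w)) * (1 - c s(u, x) * c s(v, x)) *
        ((1 - c s(u, w) * c s(u, x)) * (1 - c s(v, w) * c s(v, x)))) := by
    have h := bernExp_fourCycle (c := c) (e₁ := s(u, w)) (e₂ := s(v, w)) (e₃ := s(u, x))
      (e₄ := s(v, x)) (by grind) (by grind) (by grind) (by grind) (by grind) (by grind)
    rw [show bernExp c C = _ from h]
    exact fourCycle_le hp0 hp1 (edgeProb_eq_zero_or f p _) (edgeProb_eq_zero_or f p _)
      (edgeProb_eq_zero_or f p _) (edgeProb_eq_zero_or f p _)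
  have hval : bernExp c (fun ω => farPair u v ω * farPair w x ω) =
      (1 - c s(u, v)) * ((1 - c s(w, x)) * bernExp c C) * ∏ z ∈ Kᶜ, Q z := by
    rw [heq, bernExp_mul_prod_compl K
      (F₀ := fun ω => (1 - coord s(u, v) ω) * ((1 - coord s(w, x) ω) * C ω))
      (F := fun z ω => (1 - coord s(u, z) ω * coord s(v, z) ω) *
        (1 - coord s(w, z) ω * coord s(x, z) ω))]
    · rw [bernExp_mul_of_dependsOn (s := {s(u, v)})
        (t := {s(w, x), s(u, w), s(v, w), s(u, x), s(v, x)})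
        (dependsOn_coord (Set.mem_singleton _)).real_one_sub
        ((dependsOn_coord (by simp)).real_one_sub.real_mul (hCdep.mono (by grind)))
        (by simp only [Set.disjoint_singleton_left, Set.mem_insert_iff, Set.mem_singleton_iff,
              Sym2.eq_iff]
            grind), bernExp_mul_of_dependsOn (s := {s(w, x)})
        (dependsOn_coord (Set.mem_singleton _)).real_one_sub hCdep
        (by simp only [Set.disjoint_singleton_left, Set.mem_insert_iff, Set.mem_singleton_iff,
              Sym2.eq_iff]
            grind), bernExp_one_sub_coord, bernExp_one_sub_coord]
      congr 1
      refine Finset.prod_congr rfl fun z hz => ?_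
      have hne : ∀ {a b : V}, a ≠ b → s(a, z) ≠ s(b, z) := fun h => by
        simpa only [ne_eq, Sym2.congr_left] using h
      rw [bernExp_mul_of_dependsOn (s := {s(u, z), s(v, z)}) (t := {s(w, z), s(x, z)})
        ((dependsOn_coord (by simp)).real_mul (dependsOn_coord (by simp))).real_one_sub
        ((dependsOn_coord (by simp)).real_mul (dependsOn_coord (by simp))).real_one_sub
        (by simp [hne, Ne.symm huw, Ne.symm hux, Ne.symm hvw, Ne.symm hvx]),
        bernExp_one_sub_coord_mul (hne huv), bernExp_one_sub_coord_mul (hne hwx)]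
    · refine (dependsOn_coord_inside huK hvK).real_one_sub.real_mul
        ((dependsOn_coord_inside hwK hxK).real_one_sub.real_mul (hCdep.mono ?_))
      simp [Set.insert_subset_iff, huK, hvK, hwK, hxK]
    · exact fun z _ => ((dependsOn_coord_star huK).real_mul
        (dependsOn_coord_star hvK)).real_one_sub.real_mul
        ((dependsOn_coord_star hwK).real_mul (dependsOn_coord_star hxK)).real_one_sub
  have pv := prod_one_sub_edgeProb_mul f p u v (K := K) (by simp [hK, Finset.insert_subset_iff])
  have pw := prod_one_sub_edgeProb_mul f p w x (K := K) (by simp [hK, Finset.insert_subset_iff])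
  rw [hv, Finset.prod_pair hwx] at pv
  rw [hw, Finset.prod_pair huv, Sym2.eq_swap (a := w) (b := u),
      Sym2.eq_swap (a := x) (b := u), Sym2.eq_swap (a := w) (b := v),
      Sym2.eq_swap (a := x) (b := v)] at pw
  have hA : 0 ≤ (1 - c s(u, v)) * (1 - c s(w, x)) * ∏ z ∈ Kᶜ, Q z :=
    mul_nonneg (mul_nonneg (sub_nonneg.2 (edgeProb_mem f hp0.le hp1.le _).2)
      (sub_nonneg.2 (edgeProb_mem f hp0.le hp1.le _).2)) (Finset.prod_nonneg fun z _ => hQ z)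
  calc _ = (1 - c s(u, v)) * (1 - c s(w, x)) * (∏ z ∈ Kᶜ, Q z) *
        ((1 - p ^ 2) ^ 2 * bernExp c C) := by
        rw [hval]
        ring
    _ ≤ _ := mul_le_mul_of_nonneg_left hEC hA
    _ = _ := by
        rw [farProb, farProb, ← pv, ← pw, ← one_sub_edgeProb, ← one_sub_edgeProb,
          Finset.prod_mul_distrib]
        ring

/-- The probability `farProb` of a pair of vertices, set to `0` on the diagonal. -/
noncomputable def pairProb (f : V → ι) (p : ℝ) (u v : V) : ℝ :=
  if u = v then 0 else farProb f p (f u) (f v)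

/-- The number of ordered far pairs of vertices. -/
noncomputable def farCount (ω : Sym2 V → Bool) : ℝ :=
  ∑ u : V, ∑ v : V, if u = v then 0 else farPair u v ω

lemma pairProb_nonneg (f : V → ι) {p : ℝ} (hp0 : 0 ≤ p) (hp1 : p ≤ 1) (u v : V) :
    0 ≤ pairProb f p u v := by
  unfold pairProb
  split_ifs
  · exact le_rfl
  · exact farProb_nonneg f hp0 hp1 _ _

lemma bernExp_farCount (f : V → ι) (p : ℝ) :
    bernExp (edgeProb f p) farCount = ∑ u : V, ∑ v : V, pairProb f p u v := by
  unfold farCount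
  rw [bernExp_sum]
  refine Finset.sum_congr rfl fun u _ => ?_
  rw [bernExp_sum]
  refine Finset.sum_congr rfl fun v _ => ?_
  unfold pairProb
  split_ifs with h
  · exact bernExp_const 0
  · exact bernExp_farPair f p h

lemma bernExp_offDiag_farPair_mul_le (f : V → ι) {p : ℝ} (hp0 : 0 < p) (hp1 : p < 1) {R : ℝ}
    (hR : ∀ u, (1 + p ^ 3 / (1 - p)) ^ (Finset.univ.filter fun z => f z ≠ f u).card ≤
      (1 - p ^ 2) ^ 2 * R) (u v u' v' : V) :
    bernExp (edgeProb f p) (fun ω => (if u = v then 0 else farPair u v ω) *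
        (if u' = v' then 0 else farPair u' v' ω)) ≤
      (1 + 5 * p ^ 3 / (1 - p ^ 2) ^ 2) * (pairProb f p u v * pairProb f p u' v') +
        (if u = u' then if v = v' then pairProb f p u v else 0 else 0) +
        (if u = v' then if v = u' then pairProb f p u v else 0 else 0) +
        (if u = u' then R * (pairProb f p u v * pairProb f p u v') else 0) +
        (if u = v' then R * (pairProb f p u v * pairProb f p u u') else 0) +
        (if v = u' then R * (pairProb f p v u * pairProb f p v v') else 0) +
        (if v = v' then R * (pairProb f p v u * pairProb f p v u') else 0) := by
  have ha : 0 < 1 - p ^ 2 := by nlinarith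
  have hM := pairProb_nonneg f hp0.le hp1.le
  have hq : 0 < 1 - p := by linarith
  have hρ : 0 < 1 + p ^ 3 / (1 - p) := by positivity
  have hR0 : 0 ≤ R := by
    have := (pow_pos hρ _).trans_le (hR u)
    exact (pos_of_mul_pos_right this (sq_nonneg _)).le
  have t₁ : 0 ≤ (1 + 5 * p ^ 3 / (1 - p ^ 2) ^ 2) *
      (pairProb f p u v * pairProb f p u' v') :=
    mul_nonneg (by positivity) (mul_nonneg (hM _ _) (hM _ _))
  have tR : ∀ a b c d, 0 ≤ R * (pairProb f p a b * pairProb f p c d) := fun a b c d =>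
    mul_nonneg hR0 (mul_nonneg (hM _ _) (hM _ _))
  have ite_nonneg' : ∀ (P : Prop) (x : ℝ), 0 ≤ x → 0 ≤ if P then x else 0 := by
    intro P x hx
    split_ifs <;> simp [hx]
  have t₂ := ite_nonneg' (u = u') _ (ite_nonneg' (v = v') _ (hM u v))
  have t₃ := ite_nonneg' (u = v') _ (ite_nonneg' (v = u') _ (hM u v))
  have t₄ := ite_nonneg' (u = u') _ (tR u v u v')
  have t₅ := ite_nonneg' (u = v') _ (tR u v u u')
  have t₆ := ite_nonneg' (v = u') _ (tR v u v v')
  have t₇ := ite_nonneg' (v = v') _ (tR v u v u')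
  by_cases huv : u = v
  · simp only [if_pos huv, zero_mul]
    rw [bernExp_const]
    linarith
  by_cases huv' : u' = v'
  · simp only [if_pos huv', mul_zero]
    rw [bernExp_const]
    linarith
  simp only [if_neg huv, if_neg huv']
  have hsq : ∀ a b : V, a ≠ b →
      bernExp (edgeProb f p) (fun ω => farPair a b ω * farPair a b ω) = pairProb f p a b := by
    intro a b hab
    rw [pairProb, if_neg hab, ← bernExp_farPair f p hab]
    congr 1
    funext ω
    rcases farPair_eq_zero_or_one a b ω with h | h <;> simp [h]
  have hshare : ∀ a b d : V, a ≠ b → a ≠ d → b ≠ d →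
      bernExp (edgeProb f p) (fun ω => farPair a b ω * farPair a d ω) ≤
        R * (pairProb f p a b * pairProb f p a d) := by
    intro a b d hab had hbd
    have h := bernExp_farPair_mul_of_share f hp0 hp1 hab had hbd
    have hfar := mul_nonneg (farProb_nonneg f hp0.le hp1.le (f a) (f b))
      (farProb_nonneg f hp0.le hp1.le (f a) (f d))
    rw [pairProb, pairProb, if_neg hab, if_neg had]
    refine le_of_mul_le_mul_left (h.trans ?_) (pow_pos ha 2)
    rw [← mul_assoc ((1 - p ^ 2) ^ 2)]
    exact mul_le_mul_of_nonneg_right (hR a) hfar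
  by_cases h₁ : u = u'
  · by_cases h₂ : v = v'
    · subst h₁ h₂
      rw [hsq u v huv]
      simp only [if_true] at *
      linarith
    · subst h₁
      have := hshare u v v' huv huv' h₂
      simp only [if_true] at *
      linarith
  by_cases h₂ : u = v'
  · by_cases h₃ : v = u'
    · subst h₂ h₃
      rw [farPair_comm v u, hsq u v huv]
      simp only [if_true] at *
      linarith
    · subst h₂
      have := hshare u v u' huv h₁ h₃
      rw [farPair_comm u' u]
      simp only [if_true] at *
      linarith
  by_cases h₃ : v = u'
  · subst h₃
    have := hshare v u v' (Ne.symm huv) huv' h₂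
    rw [farPair_comm u v]
    simp only [if_true] at *
    linarith
  by_cases h₄ : v = v'
  · subst h₄
    have := hshare v u u' (Ne.symm huv) h₃ h₁
    rw [farPair_comm u v, farPair_comm u' v]
    simp only [if_true] at *
    linarith
  have h := bernExp_farPair_mul_of_disjoint f hp0 hp1 huv h₁ h₂ h₃ h₄ huv'
  have : bernExp (edgeProb f p) (fun ω => farPair u v ω * farPair u' v' ω) ≤
      (1 + 5 * p ^ 3 / (1 - p ^ 2) ^ 2) * (pairProb f p u v * pairProb f p u' v') := by
    refine le_of_mul_le_mul_left (h.trans (le_of_eq ?_)) (pow_pos ha 2)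
    rw [pairProb, pairProb, if_neg huv, if_neg huv']
    field_simp
  linarith

lemma bernExp_farCount_mul_self_le (f : V → ι) {p : ℝ} (hp0 : 0 < p) (hp1 : p < 1) {R : ℝ}
    (hR : ∀ u, (1 + p ^ 3 / (1 - p)) ^ (Finset.univ.filter fun z => f z ≠ f u).card ≤
      (1 - p ^ 2) ^ 2 * R) :
    bernExp (edgeProb f p) (fun ω => farCount ω * farCount ω) ≤
      (1 + 5 * p ^ 3 / (1 - p ^ 2) ^ 2) * (∑ u : V, ∑ v : V, pairProb f p u v) ^ 2 +
        2 * ∑ u : V, ∑ v : V, pairProb f p u v +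
        4 * R * ∑ u : V, (∑ v : V, pairProb f p u v) ^ 2 := by
  have hexp : (fun ω : Sym2 V → Bool => farCount ω * farCount ω) = fun ω =>
      ∑ u : V, ∑ v : V, ∑ u' : V, ∑ v' : V, (if u = v then 0 else farPair u v ω) *
        (if u' = v' then 0 else farPair u' v' ω) := by
    funext ω
    simp only [farCount, Finset.sum_mul]
    simp only [Finset.mul_sum]
  rw [hexp]
  simp only [bernExp_sum]
  refine (Finset.sum_le_sum fun u _ => Finset.sum_le_sum fun v _ => Finset.sum_le_sum fun u' _ =>
    Finset.sum_le_sum fun v' _ => bernExp_offDiag_farPair_mul_le f hp0 hp1 hR u v u' v').trans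
    (le_of_eq ?_)
  simp only [Finset.sum_add_distrib]
  set M := pairProb f p
  have e₁ : ∑ u : V, ∑ v : V, ∑ u' : V, ∑ v' : V,
      (1 + 5 * p ^ 3 / (1 - p ^ 2) ^ 2) * (M u v * M u' v') =
      (1 + 5 * p ^ 3 / (1 - p ^ 2) ^ 2) * (∑ u : V, ∑ v : V, M u v) ^ 2 := by
    simp only [← Finset.mul_sum, ← Finset.sum_mul, pow_two]
  have e₂ : ∑ u : V, ∑ v : V, ∑ u' : V, ∑ v' : V,
      (if u = u' then if v = v' then M u v else 0 else 0) = ∑ u : V, ∑ v : V, M u v := by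
    simp [Finset.sum_ite_irrel]
  have e₃ : ∑ u : V, ∑ v : V, ∑ u' : V, ∑ v' : V,
      (if u = v' then if v = u' then M u v else 0 else 0) = ∑ u : V, ∑ v : V, M u v := by
    simp
  have e₄ : ∑ u : V, ∑ v : V, ∑ u' : V, ∑ v' : V, (if u = u' then R * (M u v * M u v') else 0) =
      R * ∑ u : V, (∑ v : V, M u v) ^ 2 := by
    simp [Finset.sum_ite_irrel, ← Finset.mul_sum, ← Finset.sum_mul, pow_two]
  have e₅ : ∑ u : V, ∑ v : V, ∑ u' : V, ∑ v' : V, (if u = v' then R * (M u v * M u u') else 0) =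
      R * ∑ u : V, (∑ v : V, M u v) ^ 2 := by
    simp [← Finset.mul_sum, ← Finset.sum_mul, pow_two]
  have e₆ : ∑ u : V, ∑ v : V, ∑ u' : V, ∑ v' : V, (if v = u' then R * (M v u * M v v') else 0) =
      R * ∑ u : V, (∑ v : V, M u v) ^ 2 := by
    rw [Finset.sum_comm]
    simp [Finset.sum_ite_irrel, ← Finset.mul_sum, ← Finset.sum_mul, pow_two]
  have e₇ : ∑ u : V, ∑ v : V, ∑ u' : V, ∑ v' : V, (if v = v' then R * (M v u * M v u') else 0) =
      R * ∑ u : V, (∑ v : V, M u v) ^ 2 := by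
    rw [Finset.sum_comm]
    simp [← Finset.mul_sum, ← Finset.sum_mul, pow_two]
  rw [e₁, e₂, e₃, e₄, e₅, e₆, e₇]
  ring

/-- The row sums of `pairProb` depend only on the part of the vertex. -/
lemma card_part_mul_sum_pairProb_le (f : V → ι) {p : ℝ} (hp0 : 0 ≤ p) (hp1 : p ≤ 1) (u : V) :
    ((Finset.univ.filter fun z => f z = f u).card : ℝ) * ∑ v : V, pairProb f p u v ≤
      ∑ w : V, ∑ v : V, pairProb f p w v := by
  have hrow : ∀ w, ∑ v : V, pairProb f p w v =
      ∑ v : V, farProb f p (f w) (f v) - farProb f p (f w) (f w) := by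
    intro w
    rw [eq_sub_iff_add_eq, ← Finset.sum_erase_add _ _ (Finset.mem_univ w),
      ← Finset.sum_erase_add Finset.univ (fun v => farProb f p (f w) (f v))
        (Finset.mem_univ w)]
    have h0 : pairProb f p w w = 0 := if_pos rfl
    rw [h0, add_zero]
    congr 1
    exact Finset.sum_congr rfl fun v hv => if_neg (Finset.ne_of_mem_erase hv).symm
  calc _ = ∑ w ∈ Finset.univ.filter fun z => f z = f u, ∑ v : V, pairProb f p w v := by
        rw [← nsmul_eq_mul, ← Finset.sum_const]
        refine Finset.sum_congr rfl fun w hw => ?_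
        rw [hrow, hrow, (Finset.mem_filter.1 hw).2]
    _ ≤ _ := Finset.sum_le_sum_of_subset_of_nonneg (Finset.filter_subset _ _) fun w _ _ =>
        Finset.sum_nonneg fun v _ => pairProb_nonneg f hp0 hp1 w v

/-- Second moment bound for the absence of far pairs, when each part has at least `s`
vertices. -/
lemma bernExp_le_of_farCount (f : V → ι) {p : ℝ} (hp0 : 0 < p) (hp1 : p < 1) {R s : ℝ}
    (hR : ∀ u, (1 + p ^ 3 / (1 - p)) ^ (Finset.univ.filter fun z => f z ≠ f u).card ≤
      (1 - p ^ 2) ^ 2 * R) (hR0 : 0 ≤ R) (hs : 0 < s)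
    (hsf : ∀ u, s ≤ ((Finset.univ.filter fun z => f z = f u).card : ℝ))
    (hS : 0 < ∑ u : V, ∑ v : V, pairProb f p u v) {g : (Sym2 V → Bool) → ℝ}
    (hg : ∀ ω, g ω ≤ 1) (hgY : ∀ ω, farCount ω ≠ 0 → g ω ≤ 0) :
    bernExp (edgeProb f p) g ≤ 2 / (∑ u : V, ∑ v : V, pairProb f p u v) + 4 * R / s +
      5 * p ^ 3 / (1 - p ^ 2) ^ 2 := by
  have h := bernExp_mul_sq_le_variance (edgeProb_mem f hp0.le hp1.le) hg hgY
  have h2 := bernExp_farCount_mul_self_le f hp0 hp1 hR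
  rw [bernExp_farCount] at h
  set S := ∑ u : V, ∑ v : V, pairProb f p u v with hSdef
  have hD0 : ∀ u, 0 ≤ ∑ v : V, pairProb f p u v := fun u =>
    Finset.sum_nonneg fun v _ => pairProb_nonneg f hp0.le hp1.le u v
  have hD : ∑ u : V, (∑ v : V, pairProb f p u v) ^ 2 ≤ S / s * S := by
    rw [hSdef, Finset.mul_sum, ← hSdef]
    refine Finset.sum_le_sum fun u _ => ?_
    rw [pow_two]
    refine mul_le_mul_of_nonneg_right ?_ (hD0 u)
    rw [le_div_iff₀ hs, mul_comm]
    exact (mul_le_mul_of_nonneg_right (hsf u) (hD0 u)).trans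
      (card_part_mul_sum_pairProb_le f hp0.le hp1.le u)
  have h3 := mul_le_mul_of_nonneg_left hD (by positivity : 0 ≤ 4 * R)
  refine le_of_mul_le_mul_right (a := S ^ 2) ?_ (by positivity)
  have e : (2 / S + 4 * R / s + 5 * p ^ 3 / (1 - p ^ 2) ^ 2) * S ^ 2 =
      2 * S + 4 * R * (S / s * S) + 5 * p ^ 3 / (1 - p ^ 2) ^ 2 * S ^ 2 := by
    field_simp
  rw [e]
  linarith

end FarPairs

section Balanced

variable {V ι : Type*} [Fintype V] {k : ℕ}

lemma card_filter_ne_eq_sub (f : V → ι) (i : ι) :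
    ((Finset.univ.filter fun z => f z ≠ i).card : ℝ) =
      Fintype.card V - (Finset.univ.filter fun z => f z = i).card := by
  rw [eq_sub_iff_add_eq', ← Finset.card_univ]
  exact_mod_cast Finset.card_filter_add_card_filter_not (s := Finset.univ) fun z => f z = i

lemma card_filter_ne_ne_eq_sub (f : V → ι) {i j : ι} (hij : i ≠ j) :
    ((Finset.univ.filter fun z => f z ≠ i ∧ f z ≠ j).card : ℝ) =
      Fintype.card V - (Finset.univ.filter fun z => f z = i).card -
        (Finset.univ.filter fun z => f z = j).card := by
  have h := card_filter_ne_eq_sub f i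
  have h' := Finset.card_filter_add_card_filter_not (s := Finset.univ.filter fun z => f z ≠ i)
    fun z => f z = j
  rw [Finset.filter_filter, Finset.filter_filter] at h'
  have e : (Finset.univ.filter fun z => f z ≠ i ∧ f z = j) =
      Finset.univ.filter fun z => f z = j :=
    Finset.filter_congr fun z _ => ⟨And.right, fun hz => ⟨hz ▸ hij.symm, hz⟩⟩
  rw [e] at h'
  rw [← h, ← h']
  push_cast
  ring

/-- Lower bound for the expected number of far pairs containing a given vertex, when all
parts have size within `1` of `m`. -/
lemma le_sum_pairProb (f : V → ι) {p m : ℝ} (hp0 : 0 < p) (hp1 : p < 1) (hk : 2 ≤ k)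
    (hm : m * k = Fintype.card V)
    (hlo : ∀ i, m - 1 ≤ ((Finset.univ.filter fun z => f z = i).card : ℝ))
    (hhi : ∀ i, ((Finset.univ.filter fun z => f z = i).card : ℝ) ≤ m + 1) (u : V) :
    (1 - p ^ 2) ^ ((Fintype.card V : ℝ) - m + 1) * (m - 2) *
        (1 + (k - 1) * (1 - p ^ 2) ^ (1 - m) * (1 - p)) ≤ ∑ v : V, pairProb f p u v := by
  set n : ℝ := (Fintype.card V : ℝ) with hn
  set a : ℝ := 1 - p ^ 2 with haa
  have hq : 0 < 1 - p := by linarith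
  have ha : 0 < a := by rw [haa]; nlinarith
  have ha1 : a ≤ 1 := by rw [haa]; nlinarith
  have hk' : (2 : ℝ) ≤ k := by exact_mod_cast hk
  set A := a ^ (n - m + 1) with hA
  set h := a ^ (1 - m) * (1 - p) with hh
  have hA0 : 0 < A := Real.rpow_pos_of_pos ha _
  have hh0 : 0 < h := mul_pos (Real.rpow_pos_of_pos ha _) hq
  have hle : ∀ v, (if f v = f u then A else A * h) - (if v = u then A else 0) ≤
      pairProb f p u v := by
    intro v
    rw [pairProb]
    by_cases huv : v = u
    · simp [huv]
    rw [if_neg huv, if_neg (Ne.symm huv), sub_zero, farProb, ← haa]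
    by_cases hf : f v = f u
    · rw [if_pos hf, if_pos hf.symm, one_mul, hf, hA, ← Real.rpow_natCast]
      refine Real.rpow_le_rpow_of_exponent_ge ha ha1 ?_
      simp only [and_self]
      rw [card_filter_ne_eq_sub]
      linarith [hlo (f u)]
    · rw [if_neg hf, if_neg (Ne.symm hf), hh, hA, ← mul_assoc, ← Real.rpow_add ha, mul_comm,
        ← Real.rpow_natCast]
      refine mul_le_mul_of_nonneg_left (Real.rpow_le_rpow_of_exponent_ge ha ha1 ?_) hq.le
      rw [card_filter_ne_ne_eq_sub f (Ne.symm hf)]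
      linarith [hlo (f u), hlo (f v)]
  refine le_trans ?_ (Finset.sum_le_sum fun v _ => hle v)
  rw [Finset.sum_sub_distrib, Finset.sum_ite_eq' Finset.univ u, if_pos (Finset.mem_univ _),
    Finset.sum_ite, Finset.sum_const, Finset.sum_const, nsmul_eq_mul, nsmul_eq_mul,
    card_filter_ne_eq_sub, ← hn]
  have h1 := hlo (f u)
  have h2 := hhi (f u)
  set N := ((Finset.univ.filter fun z => f z = f u).card : ℝ)
  have h3 : (k - 1) * (m - 2) ≤ n - N := by nlinarith
  have h4 : (m - 2) + (k - 1) * (m - 2) * h ≤ N - 1 + (n - N) * h :=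
    add_le_add (by linarith) (mul_le_mul_of_nonneg_right h3 hh0.le)
  calc _ = A * ((m - 2) + (k - 1) * (m - 2) * h) := by rw [hh]; ring
    _ ≤ A * (N - 1 + (n - N) * h) := mul_le_mul_of_nonneg_left h4 hA0.le
    _ = _ := by ring

/-- Second moment bound for the absence of far pairs, when all parts have size within `1` of
the average part size `m`. -/
lemma bernExp_le_of_balanced (f : V → ι) {p m : ℝ} (hp0 : 0 < p) (hp1 : p < 1) (hk : 2 ≤ k)
    (hm2 : 2 < m) (hm : m * k = Fintype.card V)
    (hlo : ∀ i, m - 1 ≤ ((Finset.univ.filter fun z => f z = i).card : ℝ))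
    (hhi : ∀ i, ((Finset.univ.filter fun z => f z = i).card : ℝ) ≤ m + 1)
    {g : (Sym2 V → Bool) → ℝ} (hg : ∀ ω, g ω ≤ 1) (hgY : ∀ ω, farCount ω ≠ 0 → g ω ≤ 0) :
    bernExp (edgeProb f p) g ≤
      2 / (Fintype.card V * ((1 - p ^ 2) ^ ((Fintype.card V : ℝ) - m + 1) * (m - 2) *
        (1 + (k - 1) * (1 - p ^ 2) ^ (1 - m) * (1 - p)))) +
      (8 / m * (1 + p ^ 3 / (1 - p)) ^ ((Fintype.card V : ℝ) - m + 1) + 5 * p ^ 3) /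
        (1 - p ^ 2) ^ 2 := by
  have hq : 0 < 1 - p := by linarith
  have ha : 0 < 1 - p ^ 2 := by nlinarith
  have hρ : 1 ≤ 1 + p ^ 3 / (1 - p) := by
    have : 0 < p ^ 3 / (1 - p) := by positivity
    linarith
  have hk' : (2 : ℝ) ≤ k := by exact_mod_cast hk
  set L := (1 - p ^ 2) ^ ((Fintype.card V : ℝ) - m + 1) * (m - 2) *
    (1 + (k - 1) * (1 - p ^ 2) ^ (1 - m) * (1 - p)) with hL
  have hn0 : (0 : ℝ) < Fintype.card V := by rw [← hm]; positivity
  have hL0 : 0 < L := by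
    have h1 : 0 < m - 2 := by linarith
    have h2 : 0 < (k : ℝ) - 1 := by linarith
    rw [hL]
    positivity
  have hS : Fintype.card V * L ≤ ∑ u : V, ∑ v : V, pairProb f p u v := by
    rw [← nsmul_eq_mul, ← Finset.card_univ]
    exact Finset.card_nsmul_le_sum _ _ _ fun u _ =>
      le_sum_pairProb f hp0 hp1 hk hm hlo hhi u
  have hX : 0 ≤ (1 + p ^ 3 / (1 - p)) ^ ((Fintype.card V : ℝ) - m + 1) :=
    Real.rpow_nonneg (by linarith) _
  have h := bernExp_le_of_farCount f hp0 hp1 (s := m / 2)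
    (R := (1 + p ^ 3 / (1 - p)) ^ ((Fintype.card V : ℝ) - m + 1) / (1 - p ^ 2) ^ 2)
    (fun u => ?_) (by positivity) (by linarith) (fun u => ?_)
    ((mul_pos hn0 hL0).trans_le hS) hg hgY
  · refine h.trans ?_
    rw [add_assoc]
    refine add_le_add (div_le_div_of_nonneg_left (by norm_num) (mul_pos hn0 hL0) hS)
      (le_of_eq ?_)
    field_simp
    ring
  · rw [mul_div_cancel₀ _ (pow_pos ha 2).ne', ← Real.rpow_natCast]
    refine Real.rpow_le_rpow_of_exponent_le hρ ?_
    rw [card_filter_ne_eq_sub]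
    linarith [hlo (f u)]
  · linarith [hlo (f u)]

end Balanced

/-- Comparison of the error terms. -/
lemma error_le {k n p : ℝ} (hk : 2 ≤ k) (hn : 2 * k < n) (hp0 : 0 < p) (hp1 : p < 1) :
    8 / (n / k) * (1 + p ^ 3 / (1 - p)) ^ (n - n / k + 1) + 5 * p ^ 3 ≤
      4 * k ^ 3 * (1 + p ^ 3 / (1 - p)) ^ (n - n / k + 1) / (n * (k - 1)) := by
  have hq : 0 < 1 - p := by linarith
  have hk1 : 0 < k - 1 := by linarith
  have hn0 : 0 < n := by linarith
  have hp3 : p ^ 3 ≤ p ^ 3 / (1 - p) := by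
    rw [le_div_iff₀ hq]
    nlinarith [pow_pos hp0 3]
  have hN : n * (k - 1) / k = n - n / k := by field_simp
  have hN0 : 0 < n * (k - 1) / k := by positivity
  have hB := one_add_mul_self_le_rpow_one_add (s := p ^ 3 / (1 - p)) (p := n - n / k + 1)
    (by linarith [pow_pos hp0 3]) (by linarith)
  set X := (1 + p ^ 3 / (1 - p)) ^ (n - n / k + 1)
  have hX : n * (k - 1) / k * p ^ 3 ≤ X := by
    rw [← hN] at hB
    nlinarith [pow_pos hp0 3]
  have hX0 : 0 < X := lt_of_lt_of_le (by positivity) hX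
  have hX' : n * (k - 1) * p ^ 3 ≤ k * X := by
    have e : n * (k - 1) * p ^ 3 = k * (n * (k - 1) / k * p ^ 3) := by field_simp
    rw [e]
    exact mul_le_mul_of_nonneg_left hX (by linarith)
  rw [le_div_iff₀ (by positivity)]
  have e : (8 / (n / k) * X + 5 * p ^ 3) * (n * (k - 1)) =
      8 * k * (k - 1) * X + 5 * (n * (k - 1) * p ^ 3) := by field_simp
  rw [e]
  have : 0 ≤ k * X * ((2 * k - 1) * (2 * k - 3)) :=
    mul_nonneg (by positivity) (mul_nonneg (by linarith) (by linarith))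
  linarith

section Graphs

variable {V ι : Type*}

/-- The edge indicator of a graph. -/
noncomputable def edgeIndicator (G : SimpleGraph V) (e : Sym2 V) : Bool := decide (e ∈ G.edgeSet)

lemma edgeIndicator_eq_true {G : SimpleGraph V} {e : Sym2 V} :
    edgeIndicator G e = true ↔ e ∈ G.edgeSet := by simp [edgeIndicator]

lemma edgeIndicator_injective :
    Function.Injective (edgeIndicator : SimpleGraph V → Sym2 V → Bool) := by
  intro G H h
  refine SimpleGraph.edgeSet_injective (Set.ext fun e => ?_)
  rw [← edgeIndicator_eq_true, h, edgeIndicator_eq_true]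

lemma coord_edgeIndicator (G : SimpleGraph V) (u v : V) :
    coord s(u, v) (edgeIndicator G) = if G.Adj u v then 1 else 0 := by
  simp [coord, edgeIndicator]

variable [Fintype V]

/-- Two distinct vertices of a connected graph at distance at most `2` are not a far pair. -/
lemma farPair_edgeIndicator_eq_zero {G : SimpleGraph V} (hG : G.Connected) {u v : V}
    (huv : u ≠ v) (hd : G.dist u v ≤ 2) : farPair u v (edgeIndicator G) = 0 := by
  unfold farPair
  by_cases h : G.Adj u v
  · rw [coord_edgeIndicator, if_pos h, sub_self, zero_mul]
  obtain ⟨w, hw⟩ := hG.exists_walk_length_eq_dist u v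
  have : ∃ z, G.Adj u z ∧ G.Adj v z := by
    match w, hw with
    | .nil, _ => exact absurd rfl huv
    | .cons h₁ .nil, _ => exact absurd h₁ h
    | .cons h₁ (.cons h₂ .nil), _ => exact ⟨_, h₁, h₂.symm⟩
    | .cons h₁ (.cons h₂ (.cons h₃ w)), hw =>
      simp only [SimpleGraph.Walk.length_cons] at hw
      omega
  obtain ⟨z, hu, hv⟩ := this
  refine mul_eq_zero_of_right _ (Finset.prod_eq_zero (i := z) ?_ ?_)
  · simp [hu.ne', hv.ne']
  · rw [coord_edgeIndicator, coord_edgeIndicator, if_pos hu, if_pos hv, mul_one, sub_self]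

lemma farCount_edgeIndicator_eq_zero {G : SimpleGraph V} (hG : G.Connected)
    (hd : ∀ u v, G.dist u v ≤ 2) : farCount (edgeIndicator G) = 0 := by
  refine Finset.sum_eq_zero fun u _ => Finset.sum_eq_zero fun v _ => ?_
  split_ifs with h
  · rfl
  · exact farPair_edgeIndicator_eq_zero hG h (hd u v)

/-- The pairs of vertices with different `f`-values. -/
noncomputable def crossEdges (f : V → ι) : Finset (Sym2 V) :=
  Finset.univ.filter fun e => ¬ (e.map f).IsDiag

/-- The probability of a graph without edges inside the fibres of `f`. -/
lemma prod_edgeProb_edgeIndicator (f : V → ι) (p : ℝ) {G : SimpleGraph V}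
    (hG : ∀ u v, G.Adj u v → f u ≠ f v) :
    ∏ e, (if edgeIndicator G e then edgeProb f p e else 1 - edgeProb f p e) =
      p ^ Nat.card G.edgeSet * (1 - p) ^ ((crossEdges f).card - Nat.card G.edgeSet) := by
  have hsub : G.edgeFinset ⊆ crossEdges f := by
    intro e
    induction e using Sym2.ind with
    | _ u v =>
      intro h
      simpa [crossEdges] using hG u v (by simpa using h)
  have hcard : Nat.card G.edgeSet = G.edgeFinset.card := by
    rw [Nat.card_eq_fintype_card, SimpleGraph.edgeFinset_card]
  have hcross : ∀ e ∈ crossEdges f, edgeProb f p e = p := by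
    intro e
    induction e using Sym2.ind with
    | _ u v =>
      intro h
      exact if_neg (by simpa [crossEdges] using h)
  rw [hcard, ← Finset.card_sdiff_of_subset hsub, ← Finset.prod_const, ← Finset.prod_const,
    ← Finset.prod_subset (Finset.subset_univ (crossEdges f)), ← Finset.prod_sdiff hsub, mul_comm]
  · congr 1
    · refine Finset.prod_congr rfl fun e he => ?_
      rw [if_pos (edgeIndicator_eq_true.2 (SimpleGraph.mem_edgeFinset.1 he)),
        hcross e (hsub he)]
    · refine Finset.prod_congr rfl fun e he => ?_
      obtain ⟨he, he'⟩ := Finset.mem_sdiff.1 he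
      rw [if_neg (mt edgeIndicator_eq_true.1 (mt SimpleGraph.mem_edgeFinset.2 he')),
        hcross e he]
  · intro e _ he
    rw [if_neg (mt edgeIndicator_eq_true.1
      (mt SimpleGraph.mem_edgeFinset.2 (mt (@hsub e) he)))]
    revert he
    induction e using Sym2.ind with
    | _ u v =>
      intro h
      rw [edgeProb_mk, if_pos (by simpa [crossEdges] using h), sub_zero]

lemma card_crossEdges_sigma_fst {k : ℕ} (sz : Fin k → ℕ) :
    (crossEdges (Sigma.fst : (Σ i : Fin k, Fin (sz i)) → Fin k)).card = crossPairs k sz := by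
  have h : crossEdges (Sigma.fst : (Σ i : Fin k, Fin (sz i)) → Fin k) =
      (Finset.univ.filter fun x : (Σ i : Fin k, Fin (sz i)) × (Σ i : Fin k, Fin (sz i)) =>
        x.1.1 < x.2.1).image fun x => s(x.1, x.2) := by
    ext e
    induction e using Sym2.ind with
    | _ u v =>
      simp only [crossEdges, Finset.mem_filter, Finset.mem_univ, true_and, Sym2.map_mk,
        Sym2.mk_isDiag_iff, Finset.mem_image, Prod.exists]
      constructor
      · intro h
        rcases lt_or_gt_of_ne h with h | h
        · exact ⟨u, v, h, rfl⟩
        · exact ⟨v, u, h, Sym2.eq_swap⟩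
      · rintro ⟨a, b, hab, h⟩
        rcases Sym2.eq_iff.1 h with ⟨rfl, rfl⟩ | ⟨rfl, rfl⟩
        · exact hab.ne
        · exact hab.ne'
  rw [h, Finset.card_image_of_injOn, Finset.card_filter, Fintype.sum_prod_type, crossPairs]
  · simp only [Fintype.sum_sigma]
    refine Finset.sum_congr rfl fun i _ => ?_
    rw [Finset.sum_comm]
    refine Finset.sum_congr rfl fun j _ => ?_
    by_cases hij : i < j <;> simp [hij]
  · rintro ⟨a, b⟩ hab ⟨a', b'⟩ hab' h
    simp only [Finset.coe_filter, Finset.mem_univ, true_and, Set.mem_ofPred_eq] at hab hab'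
    rcases Sym2.eq_iff.1 h with ⟨rfl, rfl⟩ | ⟨rfl, rfl⟩
    · rfl
    · exact absurd hab hab'.asymm

lemma kpartiteDiam2Prob_le {k : ℕ} (sz : Fin k → ℕ) {p : ℝ} (hp0 : 0 ≤ p) (hp1 : p ≤ 1) :
    kpartiteDiam2Prob k sz p ≤
      bernExp (edgeProb (Sigma.fst : (Σ i : Fin k, Fin (sz i)) → Fin k) p)
        fun ω => if farCount ω = 0 then 1 else 0 := by
  unfold kpartiteDiam2Prob
  rw [← Finset.sum_filter]
  have hw := bernoulliWeight_nonneg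
    (edgeProb_mem (Sigma.fst : (Σ i : Fin k, Fin (sz i)) → Fin k) hp0 hp1)
  calc _ = ∑ ω ∈ (Finset.univ.filter fun G : SimpleGraph (Σ i : Fin k, Fin (sz i)) =>
          (∀ u v, G.Adj u v → u.1 ≠ v.1) ∧ G.Connected ∧ ∀ u v, G.dist u v ≤ 2).image
            edgeIndicator,
        (∏ e, (if ω e then edgeProb Sigma.fst p e else 1 - edgeProb Sigma.fst p e)) *
          if farCount ω = 0 then 1 else 0 := by
        rw [Finset.sum_image edgeIndicator_injective.injOn]
        refine Finset.sum_congr rfl fun G hG => ?_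
        obtain ⟨-, hf, hc, hd⟩ := Finset.mem_filter.1 hG
        rw [if_pos (farCount_edgeIndicator_eq_zero hc hd), mul_one,
          prod_edgeProb_edgeIndicator _ p hf, card_crossEdges_sigma_fst]
    _ ≤ ∑ ω, (∏ e, (if ω e then edgeProb Sigma.fst p e else 1 - edgeProb Sigma.fst p e)) *
          if farCount ω = 0 then 1 else 0 :=
        Finset.sum_le_sum_of_subset_of_nonneg (Finset.subset_univ _) fun ω _ _ =>
        mul_nonneg (hw ω) (by split_ifs <;> norm_num)
    _ = _ := by unfold bernExp; congr!

end Graphs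

lemma sum_turanSizes {k : ℕ} (hk : 0 < k) (n : ℕ) : ∑ i, turanSizes k n i = n := by
  have h : ∀ i, turanSizes k n i = n / k + if (i : ℕ) < n % k then 1 else 0 := by
    intro i
    unfold turanSizes
    split_ifs <;> rfl
  have hc : (Finset.univ.filter fun i : Fin k => (i : ℕ) < n % k).card = n % k := by
    rw [Fin.card_filter_val_lt, min_eq_right (Nat.mod_lt n hk).le]
  simp only [h, Finset.sum_add_distrib, Finset.sum_const, Finset.card_univ, Fintype.card_fin,
    smul_eq_mul, ← Finset.card_filter, hc]
  exact Nat.div_add_mod n k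

lemma turanSizes_bounds {k : ℕ} (hk : 0 < k) (n : ℕ) (i : Fin k) :
    (n : ℝ) / k - 1 ≤ turanSizes k n i ∧ (turanSizes k n i : ℝ) ≤ n / k + 1 := by
  have hk' : (0 : ℝ) < k := by exact_mod_cast hk
  have hle : ((n / k : ℕ) : ℝ) ≤ n / k := Nat.cast_div_le
  have hlt : (n : ℝ) / k ≤ (n / k : ℕ) + 1 := by
    rw [div_le_iff₀ hk']
    exact_mod_cast (Nat.lt_div_mul_add hk).le.trans (by rw [Nat.add_mul, one_mul])
  unfold turanSizes
  split_ifs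
  · push_cast
    constructor <;> linarith
  · constructor <;> linarith

lemma card_filter_sigma_fst {k : ℕ} (sz : Fin k → ℕ) (i : Fin k) :
    (Finset.univ.filter fun z : Σ i : Fin k, Fin (sz i) => z.1 = i).card = sz i := by
  rw [Finset.card_filter, Fintype.sum_sigma, Finset.sum_eq_single i]
  · simp
  · intro j _ hj
    simp [hj]
  · simp

/-- The second moment bound for Turán graphs, in terms of the average part size `n / k`. -/
lemma turanKpartiteDiam2Prob_le {k n : ℕ} (hk : 2 ≤ k) (hn : 2 * k < n) {p : ℝ} (hp0 : 0 < p)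
    (hp1 : p < 1) :
    turanKpartiteDiam2Prob k n p ≤
      2 / (n * ((1 - p ^ 2) ^ ((n : ℝ) - n / k + 1) * (n / k - 2) *
        (1 + (k - 1) * (1 - p ^ 2) ^ (1 - (n : ℝ) / k) * (1 - p)))) +
      (8 / (n / k) * (1 + p ^ 3 / (1 - p)) ^ ((n : ℝ) - n / k + 1) + 5 * p ^ 3) /
        (1 - p ^ 2) ^ 2 := by
  have hk0 : 0 < k := by omega
  have hk' : (0 : ℝ) < k := by exact_mod_cast hk0
  have hn' : 2 * (k : ℝ) < n := by exact_mod_cast hn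
  have hcard : Fintype.card (Σ i : Fin k, Fin (turanSizes k n i)) = n := by
    simp [sum_turanSizes hk0]
  have h := bernExp_le_of_balanced
    (Sigma.fst : (Σ i : Fin k, Fin (turanSizes k n i)) → Fin k) hp0 hp1 (m := n / k) hk
    (by rwa [lt_div_iff₀ hk']) (by rw [hcard]; field_simp)
    (fun i => by
      refine (turanSizes_bounds hk0 n i).1.trans_eq ?_
      rw [← card_filter_sigma_fst (turanSizes k n) i]
      congr!)
    (fun i => by
      refine le_of_eq_of_le ?_ (turanSizes_bounds hk0 n i).2
      rw [← card_filter_sigma_fst (turanSizes k n) i]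
      congr!)
    (g := fun ω => if farCount ω = 0 then 1 else 0)
    (fun ω => by split_ifs <;> norm_num) (fun ω hω => by rw [if_neg hω])
  rw [hcard] at h
  exact (kpartiteDiam2Prob_le _ hp0.le hp1.le).trans h

/-- Turán-sieve upper bound for random Turán `k`-partite graphs having diameter at
most 2. Real powers are used for the real exponents. -/
theorem turanKpartiteDiam2Prob_upper (k : ℕ) (hk : 3 ≤ k) (n : ℕ) (hn : 2 * k < n)
    (p : ℝ) (hp0 : 0 < p) (hp1 : p < 1) :
    turanKpartiteDiam2Prob k n p ≤
      (2 * (k : ℝ) / ((n : ℝ) ^ 2 * (1 - p ^ 2) ^ ((n : ℝ) * (1 - 1 / (k : ℝ)) + 1))) *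
          (1 + ((k : ℝ) - 1) * (1 - p ^ 2) ^ (1 - (n : ℝ) / (k : ℝ)) * (1 - p))⁻¹ *
          (1 - 2 * (k : ℝ) / (n : ℝ))⁻¹ +
        (4 * (k : ℝ) ^ 3 * (1 + p ^ 3 / (1 - p)) ^ ((n : ℝ) * (1 - 1 / (k : ℝ)) + 1) *
            (1 - p ^ 2) ^ (-2 : ℤ) / ((n : ℝ) * ((k : ℝ) - 1))) *
          (1 - 2 * (k : ℝ) / (n : ℝ)) ^ (-4 : ℤ) := by
  have hk' : (3 : ℝ) ≤ k := by exact_mod_cast hk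
  have hn' : 2 * (k : ℝ) < n := by exact_mod_cast hn
  have hq : 0 < 1 - p := by linarith
  have ha : 0 < 1 - p ^ 2 := by nlinarith
  have hn0 : (0 : ℝ) < n := by linarith
  have hN : (n : ℝ) * (1 - 1 / k) + 1 = n - n / k + 1 := by ring
  have h := turanKpartiteDiam2Prob_le (by omega) hn hp0 hp1
  have herr := error_le (by linarith : (2 : ℝ) ≤ k) hn' hp0 hp1
  have ht0 : 0 < 1 - 2 * (k : ℝ) / n := by rw [sub_pos, div_lt_one hn0]; exact hn'
  have ht1 : 1 - 2 * (k : ℝ) / n ≤ 1 := by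
    have : 0 < 2 * (k : ℝ) / n := by positivity
    linarith
  have ht : 1 ≤ (1 - 2 * (k : ℝ) / n) ^ (-4 : ℤ) := by
    rw [zpow_neg]
    exact (one_le_inv₀ (by positivity)).2 (by exact_mod_cast pow_le_one₀ ht0.le ht1)
  have hkn : (n : ℝ) / k - 2 = n / k * (1 - 2 * k / n) := by field_simp
  rw [hkn] at h
  rw [hN]
  have hX : 0 < (1 + p ^ 3 / (1 - p)) ^ ((n : ℝ) - n / k + 1) :=
    Real.rpow_pos_of_pos (by positivity) _
  set X := (1 + p ^ 3 / (1 - p)) ^ ((n : ℝ) - n / k + 1)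
  set A := (1 - p ^ 2) ^ ((n : ℝ) - n / k + 1)
  set B := 1 + ((k : ℝ) - 1) * (1 - p ^ 2) ^ (1 - (n : ℝ) / k) * (1 - p)
  set t := 1 - 2 * (k : ℝ) / n
  refine h.trans (add_le_add (le_of_eq ?_) ?_)
  · field_simp
  · have hk1 : 0 < (k : ℝ) - 1 := by linarith
    rw [zpow_neg, zpow_ofNat]
    calc _ ≤ 4 * (k : ℝ) ^ 3 * X / (n * (k - 1)) / (1 - p ^ 2) ^ 2 :=
          div_le_div_of_nonneg_right herr (pow_pos ha 2).le
      _ = 4 * (k : ℝ) ^ 3 * X * ((1 - p ^ 2) ^ 2)⁻¹ / (n * (k - 1)) := by field_simp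
      _ ≤ _ := le_mul_of_one_le_right (by positivity) ht
end
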